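/- Let k, n ∈ ℕ with 2^{k+1} ≤ n. Write n = 2^{a_1} + ⋯ + 2^{a_r} with a_1 > ⋯ > a_r ≥ 0, let p, q ∈ {1,…,r} be maximal with a_p ≥ k+1 and a_q ≥ k respectively, set b_j = a_j − k for 1 ≤ j ≤ q and I = {1,…,q}. Then G_k(n) = (∏_{j=q+1}^{r} 2^{a_j}) · 2^k · ∑_{{p,q} ⊆ J ⊆ I} w_G(J). -/

import Mathlib

namespace OddSym

open scoped Classical

/-- Remove one box from a row of size `p` (as multisets of parts). -/
def removeBox (lam : Multiset ℕ) (p : ℕ) : Multiset ℕ :=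
  if p ≤ 1 then lam.erase p else (p - 1) ::ₘ lam.erase p

lemma removeBox_sum_lt {lam : Multiset ℕ} {p : ℕ} (hp : p ∈ lam) (h0 : 0 < p) :
    (removeBox lam p).sum < lam.sum := by
  have h : p + (lam.erase p).sum = lam.sum := by
    conv_rhs => rw [← Multiset.cons_erase hp]
    simp [Multiset.sum_cons]
  unfold removeBox
  split
  · omega
  · simp only [Multiset.sum_cons]
    omega

/-- The number of standard Young tableaux of shape `lam`
(equivalently, the degree of the irreducible character of the symmetric
group labelled by `lam`), defined via the branching rule. -/
def degSYT (lam : Multiset ℕ) : ℕ :=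
  if _h : lam = 0 then 1
  else ∑ p ∈ (lam.toFinset.filter (fun p => 0 < p)).attach, degSYT (removeBox lam p.1)
termination_by lam.sum
decreasing_by
  have hp := p.2
  simp only [Finset.mem_filter, Multiset.mem_toFinset] at hp
  exact removeBox_sum_lt hp.1 hp.2

/-- `lam` is an odd partition: all parts positive and the number of standard
Young tableaux of shape `lam` (= the character degree) is odd. -/
def OddP (lam : Multiset ℕ) : Prop :=
  (∀ x ∈ lam, 0 < x) ∧ Odd (degSYT lam)

/-- The parts of `lam` sorted in weakly decreasing order. -/
def descList (lam : Multiset ℕ) : List ℕ :=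
  (lam.sort (· ≤ ·)).reverse

/-- The beta-set (set of beta-numbers) of `lam` with `m` beads:
`{ lam_i + (m - i) : 1 ≤ i ≤ m }` where `lam` is padded with zero parts. -/
def betaSet (lam : Multiset ℕ) (m : ℕ) : Finset ℕ :=
  (Finset.range m).image (fun i => (descList lam).getD i 0 + (m - 1 - i))

/-- `mu` is obtained from `lam` by removing an `e`-hook: in some beta-set of
`lam` a beta-number `x` is replaced by `x - e` (which is not a beta-number). -/
def IsHookRemoval (e : ℕ) (lam mu : Multiset ℕ) : Prop :=
  (∀ x ∈ lam, 0 < x) ∧ (∀ x ∈ mu, 0 < x) ∧ 0 < e ∧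
  ∃ m x, Multiset.card lam ≤ m ∧ Multiset.card mu ≤ m ∧
    x ∈ betaSet lam m ∧ e ≤ x ∧ x - e ∉ betaSet lam m ∧
    betaSet mu m = insert (x - e) ((betaSet lam m).erase x)

/-- The map `f_k` : for an odd partition `lam` with `2^k ≤ |lam|`, the unique
odd partition obtained from `lam` by removing a `2^k`-hook (junk value `0` if
no such partition exists). -/
noncomputable def fkOp (k : ℕ) (lam : Multiset ℕ) : Multiset ℕ :=
  if h : ∃ mu, IsHookRemoval (2 ^ k) lam mu ∧ OddP mu then h.choose else 0

/-- The partition encoded by a finite beta-set: each bead contributes a part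
equal to the number of gaps below it. -/
def partOfBeta (S : Finset ℕ) : Multiset ℕ :=
  (S.val.map (fun b => b - (S.filter (fun a => a < b)).card)).filter (fun p => 0 < p)

/-- The 2-quotient `(lam_0, lam_1)` of `lam`, computed from a beta-set with an
even number of beads via the two runners of the 2-abacus. -/
def quot2 (lam : Multiset ℕ) : Multiset ℕ × Multiset ℕ :=
  (partOfBeta (((betaSet lam (2 * Multiset.card lam)).filter (fun b => b % 2 = 0)).image
      (fun b => b / 2)),
   partOfBeta (((betaSet lam (2 * Multiset.card lam)).filter (fun b => b % 2 = 1)).image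
      (fun b => b / 2)))

/-- The `e`-core of `lam`: push all beads of an `e`-abacus configuration for
`lam` up as far as possible. -/
def coreP (e : ℕ) (lam : Multiset ℕ) : Multiset ℕ :=
  partOfBeta ((Finset.range (e * (Multiset.card lam + e))).filter
    (fun x => x / e <
      ((betaSet lam (Multiset.card lam + e)).filter (fun b => b % e = x % e)).card))

/-- Row `k` of the 2-quotient tower of `lam`: row 0 is `[lam]`, and row `k+1`
replaces each entry of row `k` by its 2-quotient pair. -/
def towerRow : ℕ → Multiset ℕ → List (Multiset ℕ)
  | 0, lam => [lam]
  | (k + 1), lam => (towerRow k lam).flatMap (fun mu => [(quot2 mu).1, (quot2 mu).2])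

/-- `R_k^j(lam)`: the component of row `k` of the 2-quotient tower of `lam`
from which a `2^(j-k)`-hook is removed in the passage from `lam` to `f_j(lam)`;
it is characterized by: row `k` for `f_j(lam)` is obtained from row `k` for
`lam` by replacing this component by its image under `f_(j-k)`. -/
noncomputable def Rcomp (k j : ℕ) (lam : Multiset ℕ) : Multiset ℕ :=
  if h : ∃ s, s < 2 ^ k ∧
      towerRow k (fkOp j lam) =
        (towerRow k lam).set s (fkOp (j - k) ((towerRow k lam).getD s 0))
  then (towerRow k lam).getD h.choose 0 else 0


/-- `G_k(n)`, the number of odd partitions `lam` of `n` with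
`f_k(f_k(lam)) = f_(k+1)(lam)`. -/
noncomputable def Gnum (k n : ℕ) : ℕ :=
  {lam : Multiset ℕ | OddP lam ∧ lam.sum = n ∧
    fkOp k (fkOp k lam) = fkOp (k + 1) lam}.ncard

/-- The number of gaps of `S` below `b`. -/
def gap (S : Finset ℕ) (b : ℕ) : ℕ := b - (S.filter (fun a => a < b)).card

lemma card_filter_lt_le (S : Finset ℕ) (b : ℕ) : (S.filter (fun a => a < b)).card ≤ b := by
  calc _ ≤ (Finset.range b).card := Finset.card_le_card (fun x hx => by
        simp only [Finset.mem_filter] at hx; simpa using hx.2)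
    _ = b := Finset.card_range b

lemma sum_card_filter_lt (S : Finset ℕ) :
    ∑ b ∈ S, (S.filter (fun a => a < b)).card = ∑ i ∈ Finset.range S.card, i := by
  induction S using Finset.induction_on_max with
  | empty => simp
  | insert a S h ih =>
    have ha : a ∉ S := fun h' => lt_irrefl _ (h a h')
    rw [Finset.sum_insert ha, Finset.card_insert_of_notMem ha, Finset.sum_range_succ, ← ih,
      add_comm]
    congr 1
    · refine Finset.sum_congr rfl fun b hb => ?_
      rw [Finset.filter_insert, if_neg (by have := h b hb; omega)]
    · rw [Finset.filter_insert, if_neg (lt_irrefl a), Finset.filter_true_of_mem h]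

/-- The size of the partition encoded by `S`. -/
def wt (S : Finset ℕ) : ℕ := ∑ b ∈ S, gap S b

lemma wt_add (S : Finset ℕ) : wt S + ∑ i ∈ Finset.range S.card, i = ∑ b ∈ S, b := by
  rw [← sum_card_filter_lt, wt, ← Finset.sum_add_distrib]
  exact Finset.sum_congr rfl fun b _ => Nat.sub_add_cancel (card_filter_lt_le S b)

lemma sum_filter_pos (s : Multiset ℕ) : (s.filter (fun p => 0 < p)).sum = s.sum := by
  induction s using Multiset.induction with
  | empty => simp
  | cons a s ih =>
    rcases Nat.eq_zero_or_pos a with h | h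
    · subst h; simp [ih]
    · simp [h, ih]

lemma partOfBeta_sum (S : Finset ℕ) : (partOfBeta S).sum = wt S := by
  rw [partOfBeta, sum_filter_pos]; rfl

lemma partOfBeta_pos (S : Finset ℕ) : ∀ x ∈ partOfBeta S, 0 < x := by
  intro x hx
  exact (Multiset.mem_filter.1 hx).2

/-- The beads of `S` from which an `e`-hook can be removed. -/
def mvs (e : ℕ) (S : Finset ℕ) : Finset ℕ := S.filter (fun x => e ≤ x ∧ x - e ∉ S)

/-- Move the bead `x` of `S` down by `e`. -/
def mv (e x : ℕ) (S : Finset ℕ) : Finset ℕ := insert (x - e) (S.erase x)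

lemma mem_mvs {e x : ℕ} {S : Finset ℕ} : x ∈ mvs e S ↔ x ∈ S ∧ e ≤ x ∧ x - e ∉ S := by
  simp [mvs]

lemma mem_mv {e x y : ℕ} {S : Finset ℕ} : y ∈ mv e x S ↔ y = x - e ∨ (y ≠ x ∧ y ∈ S) := by
  simp [mv]

lemma mv_card {e x : ℕ} {S : Finset ℕ} (h : x ∈ mvs e S) : (mv e x S).card = S.card := by
  rw [mem_mvs] at h
  rw [mv, Finset.card_insert_of_notMem (fun h' => h.2.2 (Finset.mem_of_mem_erase h')),
    Finset.card_erase_add_one h.1]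

lemma mv_wt {e x : ℕ} {S : Finset ℕ} (h : x ∈ mvs e S) : wt (mv e x S) + e = wt S := by
  have h1 := wt_add S
  have h2 := wt_add (mv e x S)
  rw [mv_card h] at h2
  rw [mem_mvs] at h
  have h3 : ∑ b ∈ mv e x S, b = (x - e) + ∑ b ∈ S.erase x, b :=
    Finset.sum_insert (fun h' => h.2.2 (Finset.mem_of_mem_erase h'))
  have h4 := Finset.add_sum_erase S (fun b => b) h.1
  omega

lemma mvs_eq_empty {e : ℕ} {S : Finset ℕ} (h : wt S < e) : mvs e S = ∅ := by
  refine Finset.eq_empty_of_forall_notMem fun x hx => ?_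
  have := mv_wt hx
  omega

lemma gap_zero (S : Finset ℕ) : gap S 0 = 0 := by simp [gap]

lemma gap_succ_mem {S : Finset ℕ} {b : ℕ} (h : b ∈ S) : gap S (b + 1) = gap S b := by
  have : S.filter (fun a => a < b + 1) = insert b (S.filter (fun a => a < b)) := by
    ext y; simp only [Finset.mem_filter, Finset.mem_insert]
    constructor
    · rintro ⟨h1, h2⟩
      by_cases h3 : y = b
      · exact Or.inl h3
      · exact Or.inr ⟨h1, by omega⟩
    · rintro (h1 | h1)
      · subst h1; exact ⟨h, by omega⟩
      · exact ⟨h1.1, by omega⟩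
  rw [gap, gap, this, Finset.card_insert_of_notMem (by simp)]
  omega

lemma gap_succ_notMem {S : Finset ℕ} {b : ℕ} (h : b ∉ S) : gap S (b + 1) = gap S b + 1 := by
  have : S.filter (fun a => a < b + 1) = S.filter (fun a => a < b) := by
    ext y; simp only [Finset.mem_filter]
    constructor
    · rintro ⟨h1, h2⟩
      have h3 : y ≠ b := fun h3 => h (h3 ▸ h1)
      exact ⟨h1, by omega⟩
    · rintro h1
      exact ⟨h1.1, by omega⟩
  have h1 := card_filter_lt_le S b
  rw [gap, gap, this]
  omega

lemma gap_mono (S : Finset ℕ) : Monotone (gap S) := by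
  refine monotone_nat_of_le_succ fun b => ?_
  by_cases h : b ∈ S
  · rw [gap_succ_mem h]
  · rw [gap_succ_notMem h]; omega

lemma gap_lt_of_mem_mvs {S : Finset ℕ} {x y : ℕ} (hy : y ∈ mvs 1 S) (h : x < y) :
    gap S x < gap S y := by
  rw [mem_mvs] at hy
  have h1 := gap_mono S (show x ≤ y - 1 by omega)
  have h2 := gap_succ_notMem hy.2.2
  rw [Nat.sub_add_cancel hy.2.1] at h2
  omega

lemma gap_mv_one {S : Finset ℕ} {x b : ℕ} (hx : x ∈ mvs 1 S) (hb : b ∈ S.erase x) :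
    gap (mv 1 x S) b = gap S b := by
  rw [mem_mvs] at hx
  rw [Finset.mem_erase] at hb
  have hbx : b ≠ x - 1 := fun h => hx.2.2 (h ▸ hb.2)
  unfold gap
  congr 1
  rcases lt_or_gt_of_ne hb.1 with h | h
  · congr 1
    ext y
    simp only [Finset.mem_filter, mem_mv]
    constructor
    · rintro ⟨h1 | h1, h2⟩
      · omega
      · exact ⟨h1.2, h2⟩
    · rintro ⟨h1, h2⟩
      exact ⟨Or.inr ⟨by omega, h1⟩, h2⟩
  · have : (mv 1 x S).filter (fun a => a < b) = mv 1 x (S.filter (fun a => a < b)) := by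
      ext y
      simp only [Finset.mem_filter, mem_mv]
      constructor
      · rintro ⟨h1 | h1, h2⟩
        · exact Or.inl h1
        · exact Or.inr ⟨h1.1, h1.2, h2⟩
      · rintro (h1 | h1)
        · exact ⟨Or.inl h1, by omega⟩
        · exact ⟨Or.inr ⟨h1.1, h1.2.1⟩, h1.2.2⟩
    rw [this, mv_card]
    simp only [mem_mvs, Finset.mem_filter]
    exact ⟨⟨hx.1, h⟩, hx.2.1, fun h' => hx.2.2 h'.1⟩

lemma gap_mv_one_self {S : Finset ℕ} {x : ℕ} (hx : x ∈ mvs 1 S) :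
    gap (mv 1 x S) (x - 1) + 1 = gap S x := by
  rw [mem_mvs] at hx
  have h2 := gap_succ_notMem hx.2.2
  rw [Nat.sub_add_cancel hx.2.1] at h2
  rw [h2]
  congr 1
  unfold gap
  congr 2
  ext y
  simp only [Finset.mem_filter, mem_mv]
  constructor
  · rintro ⟨h1 | h1, h2⟩
    · omega
    · exact ⟨h1.2, h2⟩
  · rintro ⟨h1, h2⟩
    exact ⟨Or.inr ⟨by omega, h1⟩, h2⟩

lemma removeBox_partOfBeta {S : Finset ℕ} {x : ℕ} (hx : x ∈ mvs 1 S) :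
    removeBox (partOfBeta S) (gap S x) = partOfBeta (mv 1 x S) := by
  have hself := gap_mv_one_self hx
  have e1 : S.val = x ::ₘ (S.erase x).val := by
    rw [Finset.erase_val, Multiset.cons_erase (mem_mvs.1 hx).1]
  have hni : x - 1 ∉ S.erase x := fun h => (mem_mvs.1 hx).2.2 (Finset.mem_of_mem_erase h)
  have e2 : (mv 1 x S).val = (x - 1) ::ₘ (S.erase x).val := by
    rw [mv, Finset.insert_val_of_notMem hni]
  have e3 : (S.erase x).val.map (gap (mv 1 x S)) = (S.erase x).val.map (gap S) :=
    Multiset.map_congr rfl fun b hb => gap_mv_one hx hb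
  have e4 : partOfBeta S =
      gap S x ::ₘ ((S.erase x).val.map (gap S)).filter (fun p => 0 < p) := by
    change (S.val.map (gap S)).filter _ = _
    rw [e1, Multiset.map_cons, Multiset.filter_cons_of_pos]
    omega
  have e5 : partOfBeta (mv 1 x S) = (gap (mv 1 x S) (x - 1) ::ₘ
      (S.erase x).val.map (gap S)).filter (fun p => 0 < p) := by
    change ((mv 1 x S).val.map (gap (mv 1 x S))).filter _ = _
    rw [e2, Multiset.map_cons, e3]
  rw [e4, e5, removeBox, Multiset.erase_cons_head]
  split_ifs with h
  · rw [Multiset.filter_cons_of_neg]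
    omega
  · rw [Multiset.filter_cons_of_pos _ (by omega), show gap (mv 1 x S) (x - 1) = gap S x - 1 by omega]

lemma degSYT_partOfBeta {S : Finset ℕ} (h : 0 < wt S) :
    degSYT (partOfBeta S) = ∑ x ∈ mvs 1 S, degSYT (partOfBeta (mv 1 x S)) := by
  have h0 : partOfBeta S ≠ 0 := by
    intro h0
    rw [← partOfBeta_sum, h0] at h
    simp at h
  rw [degSYT, dif_neg h0, Finset.sum_attach ((partOfBeta S).toFinset.filter (fun p => 0 < p))
    (fun p => degSYT (removeBox (partOfBeta S) p))]
  symm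
  refine Finset.sum_bij (fun x _ => gap S x) ?_ ?_ ?_ ?_
  · intro x hx
    have := gap_mv_one_self hx
    simp only [Finset.mem_filter, Multiset.mem_toFinset, partOfBeta, Multiset.mem_filter,
      Multiset.mem_map]
    exact ⟨⟨⟨x, (mem_mvs.1 hx).1, rfl⟩, by omega⟩, by omega⟩
  · intro x hx y hy hxy
    rcases lt_trichotomy x y with h1 | h1 | h1
    · have := gap_lt_of_mem_mvs hy h1; omega
    · exact h1
    · have := gap_lt_of_mem_mvs hx h1; omega
  · intro p hp
    simp only [Finset.mem_filter, Multiset.mem_toFinset, partOfBeta, Multiset.mem_filter,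
      Multiset.mem_map] at hp
    obtain ⟨⟨⟨b, hb, hbp⟩, -⟩, hpos⟩ := hp
    have hex : ∃ b, b ∈ S ∧ gap S b = p := ⟨b, hb, hbp⟩
    obtain ⟨h1, h2⟩ := Nat.find_spec hex
    have hmin := fun c => Nat.find_min hex (m := c)
    set c := Nat.find hex
    have hc : 1 ≤ c := by
      rcases Nat.eq_zero_or_pos c with h3 | h3
      · rw [h3, gap_zero] at h2; omega
      · exact h3
    refine ⟨c, mem_mvs.2 ⟨h1, hc, fun h4 => ?_⟩, h2⟩
    refine hmin (c - 1) (by omega) ⟨h4, ?_⟩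
    rw [← gap_succ_mem h4, Nat.sub_add_cancel hc, h2]
  · intro x hx
    rw [removeBox_partOfBeta hx]

/-- The parity of the number of standard tableaux of the partition encoded by `S`. -/
noncomputable def par (S : Finset ℕ) : ZMod 2 := (degSYT (partOfBeta S) : ZMod 2)

lemma par_rec {S : Finset ℕ} (h : 0 < wt S) : par S = ∑ x ∈ mvs 1 S, par (mv 1 x S) := by
  simp only [par]
  rw [degSYT_partOfBeta h, Nat.cast_sum]

lemma par_of_wt {S : Finset ℕ} (h : wt S = 0) : par S = 1 := by
  have h0 : partOfBeta S = 0 := by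
    rw [← partOfBeta_sum, Multiset.sum_eq_zero_iff] at h
    refine Multiset.eq_zero_of_forall_notMem fun x hx => ?_
    have h1 := partOfBeta_pos S x hx
    have h2 := h x hx
    omega
  rw [par, h0, degSYT]
  simp

lemma par_cases (S : Finset ℕ) : par S = 0 ∨ par S = 1 := by
  generalize par S = z
  revert z
  decide

lemma wt_range (c : ℕ) : wt (Finset.range c) = 0 := by
  have := wt_add (Finset.range c)
  rw [Finset.card_range] at this
  omega

lemma eq_range_of_wt {S : Finset ℕ} (h : wt S = 0) : S = Finset.range S.card := by
  have key : ∀ b ∈ S, gap S b = 0 := by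
    intro b hb
    exact (Finset.sum_eq_zero_iff.1 h) b hb
  refine Finset.eq_of_subset_of_card_le (fun b hb => ?_) (by simp)
  have h1 := key b hb
  have h2 : (S.filter (fun a => a < b)).card < S.card := by
    refine Finset.card_lt_card ⟨Finset.filter_subset _ _, fun h3 => ?_⟩
    have := (Finset.mem_filter.1 (h3 hb)).2
    omega
  unfold gap at h1
  rw [Finset.mem_range]
  omega

lemma mv_mv_comm {e x y : ℕ} {S : Finset ℕ} (hx : x ∈ mvs e S) (hy : y ∈ mvs e S) :
    mv e y (mv e x S) = mv e x (mv e y S) := by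
  rw [mem_mvs] at hx hy
  have h1 : x - e ≠ y := fun h => hx.2.2 (h ▸ hy.1)
  have h2 : y - e ≠ x := fun h => hy.2.2 (h ▸ hx.1)
  ext z
  simp only [mem_mv]
  constructor
  · rintro (h | ⟨h, h' | h'⟩)
    · exact Or.inr ⟨by omega, Or.inl h⟩
    · exact Or.inl h'
    · exact Or.inr ⟨h'.1, Or.inr ⟨h, h'.2⟩⟩
  · rintro (h | ⟨h, h' | h'⟩)
    · exact Or.inr ⟨by omega, Or.inl h⟩
    · exact Or.inl h'
    · exact Or.inr ⟨h'.1, Or.inr ⟨h, h'.2⟩⟩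

/-- Removing `e`-hooks twice is, modulo two, the same as removing a `2e`-hook. -/
lemma sum_mv_mv (g : Finset ℕ → ZMod 2) {e : ℕ} (he : 0 < e) (S : Finset ℕ) :
    ∑ x ∈ mvs e S, ∑ y ∈ mvs e (mv e x S), g (mv e y (mv e x S)) =
      ∑ x ∈ mvs (2 * e) S, g (mv (2 * e) x S) := by
  rw [Finset.sum_sigma' (mvs e S) (fun x => mvs e (mv e x S))
    (fun x y => g (mv e y (mv e x S)))]
  rw [← Finset.sum_filter_add_sum_filter_not _ (fun z : (_ : ℕ) × ℕ => z.2 = z.1 - e)]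
  rw [← Finset.sum_filter_add_sum_filter_not
    (((mvs e S).sigma fun x => mvs e (mv e x S)).filter (fun z => ¬ z.2 = z.1 - e))
    (fun z : (_ : ℕ) × ℕ => z.2 = z.1 + e)]
  rw [← Finset.sum_filter_add_sum_filter_not (mvs (2 * e) S) (fun x => x - e ∉ S)]
  have h3 : ∑ z ∈ (((mvs e S).sigma fun x => mvs e (mv e x S)).filter
      (fun z => ¬ z.2 = z.1 - e)).filter (fun z : (_ : ℕ) × ℕ => ¬ z.2 = z.1 + e),
      g (mv e z.2 (mv e z.1 S)) = 0 := by
    have hmem : ∀ z : (_ : ℕ) × ℕ, z ∈ (((mvs e S).sigma fun x => mvs e (mv e x S)).filter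
      (fun z => ¬ z.2 = z.1 - e)).filter (fun z : (_ : ℕ) × ℕ => ¬ z.2 = z.1 + e) ↔
        z.1 ∈ mvs e S ∧ z.2 ∈ mvs e S ∧ z.1 ≠ z.2 := by
      rintro ⟨x, y⟩
      simp only [Finset.mem_filter, Finset.mem_sigma, mem_mvs, mem_mv]
      constructor
      · rintro ⟨⟨⟨⟨hx, hxe, hxn⟩, ⟨hy, hye, hyn⟩⟩, h1⟩, h2⟩
        push Not at hyn
        have hy' := hy.resolve_left h1
        refine ⟨⟨hx, hxe, hxn⟩, ⟨hy'.2, hye, fun h => ?_⟩, fun h => hy'.1 h.symm⟩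
        exact hyn.2 (by omega) h
      · rintro ⟨⟨hx, hxe, hxn⟩, ⟨hy, hye, hyn⟩, hxy⟩
        refine ⟨⟨⟨⟨hx, hxe, hxn⟩, ⟨Or.inr ⟨hxy.symm, hy⟩, hye, ?_⟩⟩, ?_⟩, ?_⟩
        · push Not
          exact ⟨by omega, fun _ => hyn⟩
        · intro h; exact hxn (h ▸ hy)
        · intro h; apply hyn; rw [h, Nat.add_sub_cancel]; exact hx
    refine Finset.sum_involution (fun z _ => ⟨z.2, z.1⟩) ?_ ?_ ?_ ?_
    · rintro ⟨x, y⟩ hz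
      rw [hmem] at hz
      change g (mv e y (mv e x S)) + g (mv e x (mv e y S)) = 0
      rw [mv_mv_comm hz.1 hz.2.1]
      exact CharTwo.add_self_eq_zero _
    · rintro ⟨x, y⟩ hz - h
      rw [hmem] at hz
      simp only [Sigma.mk.injEq] at h
      exact hz.2.2 h.1.symm
    · rintro ⟨x, y⟩ hz
      rw [hmem] at hz ⊢
      exact ⟨hz.2.1, hz.1, hz.2.2.symm⟩
    · rintro ⟨x, y⟩ hz
      rfl
  rw [h3, add_zero]
  congr 1
  · refine Finset.sum_bij' (fun z _ => z.1) (fun x _ => ⟨x, x - e⟩) ?_ ?_ ?_ ?_ ?_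
    · rintro ⟨x, y⟩ hz
      simp only [Finset.mem_filter, Finset.mem_sigma, mem_mvs, mem_mv] at hz ⊢
      obtain ⟨⟨⟨hx, hxe, hxn⟩, ⟨hy, hye, hyn⟩⟩, h1⟩ := hz
      subst h1
      push Not at hyn
      refine ⟨⟨hx, by omega, ?_⟩, hxn⟩
      have := hyn.2 (by omega)
      rwa [Nat.sub_sub, ← two_mul] at this
    · intro x hx
      simp only [Finset.mem_filter, Finset.mem_sigma, mem_mvs, mem_mv] at hx ⊢
      obtain ⟨⟨hx, hxe, hxn⟩, h1⟩ := hx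
      refine ⟨⟨⟨hx, by omega, h1⟩, Or.inl trivial, by omega, ?_⟩, trivial⟩
      push Not
      refine ⟨by omega, fun _ => ?_⟩
      rwa [Nat.sub_sub, ← two_mul]
    · rintro ⟨x, y⟩ hz
      rw [Finset.mem_filter] at hz
      simp only [Sigma.mk.injEq, true_and]
      exact heq_of_eq hz.2.symm
    · intro x hx
      rfl
    · rintro ⟨x, y⟩ hz
      simp only [Finset.mem_filter, Finset.mem_sigma, mem_mvs, mem_mv] at hz ⊢
      obtain ⟨⟨⟨hx, hxe, hxn⟩, ⟨hy, hye, hyn⟩⟩, h1⟩ := hz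
      subst h1
      congr 1
      ext z
      simp only [mem_mv]
      rw [Nat.sub_sub, ← two_mul]
      constructor
      · rintro (h | ⟨h, h' | h'⟩)
        · exact Or.inl h
        · omega
        · exact Or.inr h'
      · rintro (h | h)
        · exact Or.inl h
        · refine Or.inr ⟨fun h' => hxn (h' ▸ h.2), Or.inr h⟩
  · refine Finset.sum_bij' (fun z _ => z.2) (fun x _ => ⟨x - e, x⟩) ?_ ?_ ?_ ?_ ?_
    · rintro ⟨x, y⟩ hz
      simp only [Finset.mem_filter, Finset.mem_sigma, mem_mvs, mem_mv] at hz ⊢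
      obtain ⟨⟨⟨⟨hx, hxe, hxn⟩, ⟨hy, hye, hyn⟩⟩, h1⟩, h2⟩ := hz
      subst h2
      refine ⟨⟨(hy.resolve_left h1).2, by omega, ?_⟩, ?_⟩
      · rwa [two_mul, ← Nat.sub_sub, Nat.add_sub_cancel]
      · rw [Nat.add_sub_cancel]; exact fun h => h hx
    · intro x hx
      simp only [Finset.mem_filter, Finset.mem_sigma, mem_mvs, mem_mv, not_not] at hx ⊢
      obtain ⟨⟨hx, hxe, hxn⟩, h1⟩ := hx
      refine ⟨⟨⟨⟨h1, by omega, ?_⟩, Or.inr ⟨by omega, hx⟩, by omega, ?_⟩, by omega⟩, by omega⟩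
      · rwa [Nat.sub_sub, ← two_mul]
      · push Not
        exact ⟨by omega, fun h => absurd rfl h⟩
    · rintro ⟨x, y⟩ hz
      rw [Finset.mem_filter] at hz
      have := hz.2
      simp only at this
      subst this
      simp
    · intro x hx
      rfl
    · rintro ⟨x, y⟩ hz
      simp only [Finset.mem_filter, Finset.mem_sigma, mem_mvs, mem_mv] at hz ⊢
      obtain ⟨⟨⟨⟨hx, hxe, hxn⟩, ⟨hy, hye, hyn⟩⟩, h1⟩, h2⟩ := hz
      subst h2
      congr 1
      ext z
      simp only [mem_mv]
      rw [two_mul, ← Nat.sub_sub, Nat.add_sub_cancel]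
      constructor
      · rintro (h | ⟨h, h' | h'⟩)
        · exact Or.inr ⟨by omega, h ▸ hx⟩
        · exact Or.inl h'
        · exact Or.inr ⟨h, h'.2⟩
      · rintro (h | h)
        · exact Or.inr ⟨by omega, Or.inl h⟩
        · by_cases hz : z = x
          · exact Or.inl hz
          · exact Or.inr ⟨h.1, Or.inr ⟨hz, h.2⟩⟩

lemma par_hook (k : ℕ) {S : Finset ℕ} (h : 2 ^ k ≤ wt S) :
    par S = ∑ x ∈ mvs (2 ^ k) S, par (mv (2 ^ k) x S) := by
  induction k generalizing S with
  | zero => exact par_rec h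
  | succ k ih =>
    rw [pow_succ'] at h
    rw [pow_succ', ← sum_mv_mv par (by positivity), ih (by omega)]
    refine Finset.sum_congr rfl fun x hx => ih ?_
    have := mv_wt hx
    omega

lemma exists_odd_mv {k : ℕ} {S : Finset ℕ} (h : 2 ^ k ≤ wt S) (hS : par S = 1) :
    ∃ x ∈ mvs (2 ^ k) S, par (mv (2 ^ k) x S) = 1 := by
  rw [par_hook k h] at hS
  obtain ⟨x, hx, hne⟩ := Finset.exists_ne_zero_of_sum_ne_zero (hS.trans_ne one_ne_zero)
  exact ⟨x, hx, (par_cases _).resolve_left hne⟩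

lemma mvs_subsingleton {N : ℕ} {X : Finset ℕ} (h : wt X < 2 * N) {u v : ℕ}
    (hu : u ∈ mvs N X) (hv : v ∈ mvs N X) : u = v := by
  by_contra huv
  have h1 := mv_wt hu
  have h2 : v ∈ mvs N (mv N u X) := by
    rw [mem_mvs] at hu hv ⊢
    simp only [mem_mv]
    refine ⟨Or.inr ⟨fun h => huv h.symm, hv.1⟩, hv.2.1, ?_⟩
    push Not
    exact ⟨by omega, fun _ => hv.2.2⟩
  have h3 := mv_wt h2
  omega

/-- The removable box of the `N`-core `mv N z S` corresponding to a removable box of `S`. -/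
lemma exists_core_mv {a : ℕ} {S : Finset ℕ} {x z : ℕ} (hlt : wt S < 2 * 2 ^ a)
    (hlt' : 2 ^ a < wt S) (hz : z ∈ mvs (2 ^ a) S) (hx : x ∈ mvs 1 S)
    (hodd : par (mv 1 x S) = 1) :
    ∃ x', x' ∈ mvs 1 (mv (2 ^ a) z S) ∧ par (mv 1 x' (mv (2 ^ a) z S)) = 1 ∧
      x' = if x = z then z - 2 ^ a else if x = z - 2 ^ a + 1 then z + 1 else x := by
  have hN : 0 < 2 ^ a := by positivity
  have hTwt := mv_wt hz
  have hXwt := mv_wt hx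
  obtain ⟨u, hu, hu1⟩ := exists_odd_mv (k := a) (by omega) hodd
  have hcore : ∀ t, t ∈ mv (2 ^ a) z S → 2 ^ a ≤ t → t - 2 ^ a ∈ mv (2 ^ a) z S := by
    intro t ht hle
    by_contra hn
    have h1 : t ∈ mvs (2 ^ a) (mv (2 ^ a) z S) := mem_mvs.2 ⟨ht, hle, hn⟩
    rw [mvs_eq_empty (by omega)] at h1
    simp at h1
  have hu' := hu
  generalize 2 ^ a = N at *
  rw [mem_mvs] at hz hx hu
  simp only [mem_mv] at hu hcore
  obtain ⟨hz1, hz2, hz3⟩ := hz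
  obtain ⟨hx1, hx2, hx3⟩ := hx
  obtain ⟨hua, hub, huc⟩ := hu
  push Not at huc
  by_cases hxz : x = z
  · subst hxz
    rw [if_pos rfl]
    have huz : u = x - 1 := by
      by_contra hne
      have h1 := hua.resolve_left hne
      have h2 := hcore u (Or.inr h1) hub
      rcases h2 with h2 | h2
      · omega
      · exact huc.2 h2.1 h2.2
    subst huz
    have hn : x - N - 1 ∉ S := by
      intro h
      refine huc.2 (by omega) ?_
      rwa [Nat.sub_right_comm]
    refine ⟨x - N, ?_, ?_, rfl⟩
    · rw [mem_mvs]
      simp only [mem_mv]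
      refine ⟨Or.inl trivial, by omega, ?_⟩
      push Not
      exact ⟨by omega, fun _ => hn⟩
    · rw [← hu1]
      congr 1
      ext y
      simp only [mem_mv]
      rw [Nat.sub_right_comm]
      constructor
      · rintro (h | ⟨h1, h2 | h2⟩)
        · exact Or.inl h
        · exact absurd h2 h1
        · exact Or.inr ⟨fun h => hx3 (h ▸ h2.2), Or.inr h2⟩
      · rintro (h | ⟨h1, h2 | h2⟩)
        · exact Or.inl h
        · exact absurd h2 h1
        · exact Or.inr ⟨fun h => hz3 (h ▸ h2.2), Or.inr h2⟩
  · rw [if_neg hxz]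
    by_cases hxz' : x = z - N + 1
    · rw [if_pos hxz']
      subst hxz'
      have hN1 : N ≠ 1 := by omega
      have huz : u = z + 1 := by
        rcases hua with h | ⟨h1, h2⟩
        · exfalso
          have h3 := hcore (z - N) (Or.inl rfl) (by omega)
          rcases h3 with h3 | ⟨h3, h4⟩
          · omega
          · refine huc.2 (by omega) ?_
            rw [h]; rwa [Nat.add_sub_cancel]
        · by_cases huz : u = z
          · exfalso; subst huz; exact huc.1 (by omega)
          · rcases hcore u (Or.inr ⟨huz, h2⟩) hub with h3 | h3
            · omega
            · by_contra h4
              exact huc.2 (by omega) h3.2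
      subst huz
      have hzS : z + 1 ∈ S := (hua.resolve_left (by omega)).2
      refine ⟨z + 1, ?_, ?_, rfl⟩
      · rw [mem_mvs]
        simp only [mem_mv]
        refine ⟨Or.inr ⟨by omega, hzS⟩, by omega, ?_⟩
        push Not
        exact ⟨by omega, fun h => absurd (by omega) h⟩
      · rw [← hu1]
        congr 1
        ext y
        simp only [mem_mv]
        constructor
        · rintro (h | ⟨h1, h2 | h2⟩)
          · exact Or.inr ⟨by omega, Or.inr ⟨by omega, by rw [h]; exact hz1⟩⟩
          · exact Or.inr ⟨by omega, Or.inl (by omega)⟩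
          · by_cases hy : y = z - N + 1
            · exact Or.inl (by omega)
            · exact Or.inr ⟨h1, Or.inr ⟨hy, h2.2⟩⟩
        · rintro (h | ⟨h1, h2 | h2⟩)
          · exact Or.inr ⟨by omega, Or.inr ⟨by omega, by
              rw [h, show z + 1 - N = z - N + 1 by omega]; exact hx1⟩⟩
          · exact Or.inr ⟨h1, Or.inl (by omega)⟩
          · by_cases hy : y = z
            · exact Or.inl (by omega)
            · exact Or.inr ⟨h1, Or.inr ⟨hy, h2.2⟩⟩
    · rw [if_neg hxz']
      have hxzN : x ≠ z - N := fun h => hz3 (h ▸ hx1)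
      have hx1z : x - 1 ≠ z := fun h => hx3 (h ▸ hz1)
      have hzX : z ∈ mvs N (mv 1 x S) := by
        rw [mem_mvs]
        simp only [mem_mv]
        refine ⟨Or.inr ⟨fun h => hxz h.symm, hz1⟩, hz2, ?_⟩
        push Not
        exact ⟨by omega, fun _ => hz3⟩
      have huz : u = z := mvs_subsingleton (by omega) hu' hzX
      subst huz
      refine ⟨x, ?_, ?_, rfl⟩
      · rw [mem_mvs]
        simp only [mem_mv]
        refine ⟨Or.inr ⟨hxz, hx1⟩, hx2, ?_⟩
        push Not
        exact ⟨by omega, fun _ => hx3⟩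
      · rw [← hu1]
        congr 1
        ext y
        simp only [mem_mv]
        constructor
        · rintro (h | ⟨h, h' | h'⟩)
          · exact Or.inr ⟨by omega, Or.inl h⟩
          · exact Or.inl h'
          · exact Or.inr ⟨h'.1, Or.inr ⟨h, h'.2⟩⟩
        · rintro (h | ⟨h, h' | h'⟩)
          · exact Or.inr ⟨by omega, Or.inl h⟩
          · exact Or.inl h'
          · exact Or.inr ⟨h'.1, Or.inr ⟨h, h'.2⟩⟩

lemma odd_mv_one_unique {S : Finset ℕ} (hS : par S = 1) {x y : ℕ} (hx : x ∈ mvs 1 S)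
    (hy : y ∈ mvs 1 S) (hxo : par (mv 1 x S) = 1) (hyo : par (mv 1 y S) = 1) : x = y := by
  induction hn : wt S using Nat.strong_induction_on generalizing S x y with
  | _ n ih =>
  have hpos : 0 < wt S := by have := mv_wt hx; omega
  obtain ⟨a, ha⟩ : ∃ a, a = Nat.log 2 (wt S) := ⟨_, rfl⟩
  have hle : 2 ^ a ≤ wt S := ha ▸ Nat.pow_log_le_self 2 hpos.ne'
  have hlt : wt S < 2 * 2 ^ a := by
    rw [← pow_succ', ha]; exact Nat.lt_pow_succ_log_self (by norm_num) _
  obtain ⟨z, hz, hzo⟩ := exists_odd_mv hle hS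
  have hTwt := mv_wt hz
  have hN : 0 < 2 ^ a := by positivity
  rcases hle.lt_or_eq with hlt' | heq
  · obtain ⟨x', hx', hxo', hxe⟩ := exists_core_mv hlt hlt' hz hx hxo
    obtain ⟨y', hy', hyo', hye⟩ := exists_core_mv hlt hlt' hz hy hyo
    have hxy := ih _ (by omega) hzo hx' hy' hxo' hyo' rfl
    rw [hxe, hye] at hxy
    rw [mem_mvs] at hx hy hz
    have hx0 : x ≠ z - 2 ^ a := fun h => hz.2.2 (h ▸ hx.1)
    have hy0 : y ≠ z - 2 ^ a := fun h => hz.2.2 (h ▸ hy.1)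
    have hx1 : x ≠ z + 1 := fun h => hx.2.2 (by rw [h]; exact hz.1)
    have hy1 : y ≠ z + 1 := fun h => hy.2.2 (by rw [h]; exact hz.1)
    split_ifs at hxy <;> omega
  · by_contra hne
    have hT := eq_range_of_wt (S := mv (2 ^ a) z S) (by omega)
    have hmem : ∀ t, t ∈ mv (2 ^ a) z S → t - 1 ∈ mv (2 ^ a) z S := by
      intro t ht
      rw [hT, Finset.mem_range] at ht ⊢
      omega
    have hsub : ∀ t ∈ mvs 1 S, t = z ∨ t = z - 2 ^ a + 1 := by
      intro t ht
      rw [mem_mvs] at ht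
      by_contra h
      push Not at h
      have h1 := hmem t (mem_mv.2 (Or.inr ⟨h.1, ht.1⟩))
      rcases mem_mv.1 h1 with h2 | h2
      · omega
      · exact ht.2.2 h2.2
    have hpair : mvs 1 S = {x, y} := by
      ext t
      rw [Finset.mem_insert, Finset.mem_singleton]
      constructor
      · intro ht
        have h1 := hsub t ht
        have h2 := hsub x hx
        have h3 := hsub y hy
        omega
      · rintro (h | h)
        · exact h ▸ hx
        · exact h ▸ hy
    rw [par_rec hpos, hpair, Finset.sum_pair hne, hxo, hyo] at hS
    revert hS
    decide

/-- The beads of `S` on the runner `s` of the `E`-abacus. -/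
def run {E : ℕ} (S : Finset ℕ) (s : Fin E) : Finset ℕ :=
  (S.filter (fun x => x % E = s)).image (fun x => x / E)

/-- The bead set with prescribed runners on the `E`-abacus. -/
def asm {E : ℕ} (T : Fin E → Finset ℕ) : Finset ℕ :=
  (Finset.univ.sigma T).image (fun z => E * z.2 + z.1)

/-- Push all beads up on every runner of the `E`-abacus. -/
def coreB (E : ℕ) (S : Finset ℕ) : Finset ℕ :=
  asm (fun s : Fin E => Finset.range (run S s).card)

lemma runner_div {E : ℕ} (s : Fin E) (y : ℕ) : (E * y + s) / E = y := by
  rw [Nat.mul_add_div s.pos, Nat.div_eq_of_lt s.isLt, add_zero]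

lemma runner_mod {E : ℕ} (s : Fin E) (y : ℕ) : (E * y + s) % E = s := by
  rw [Nat.mul_add_mod, Nat.mod_eq_of_lt s.isLt]

lemma runner_inj {E : ℕ} {s t : Fin E} {y z : ℕ} (h : E * y + s = E * z + t) : s = t ∧ y = z := by
  constructor
  · ext
    rw [← runner_mod s y, h, runner_mod]
  · rw [← runner_div s y, h, runner_div]

lemma exists_runner {E : ℕ} (hE : 0 < E) (x : ℕ) : ∃ (s : Fin E) (y : ℕ), x = E * y + s :=
  ⟨⟨x % E, Nat.mod_lt _ hE⟩, x / E, (Nat.div_add_mod x E).symm⟩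

lemma mem_run {E : ℕ} {S : Finset ℕ} {s : Fin E} {y : ℕ} : y ∈ run S s ↔ E * y + s ∈ S := by
  simp only [run, Finset.mem_image, Finset.mem_filter]
  constructor
  · rintro ⟨x, ⟨h1, h2⟩, h3⟩
    rw [← h2, ← h3, Nat.div_add_mod]
    exact h1
  · intro h
    exact ⟨_, ⟨h, runner_mod s y⟩, runner_div s y⟩

lemma mem_asm {E : ℕ} {T : Fin E → Finset ℕ} {s : Fin E} {y : ℕ} :
    E * y + s ∈ asm T ↔ y ∈ T s := by
  simp only [asm, Finset.mem_image, Finset.mem_sigma, Finset.mem_univ, true_and, Sigma.exists]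
  constructor
  · rintro ⟨t, z, h1, h2⟩
    obtain ⟨rfl, rfl⟩ := runner_inj h2
    exact h1
  · intro h
    exact ⟨s, y, h, rfl⟩

lemma run_asm {E : ℕ} (T : Fin E → Finset ℕ) : run (asm T) = T := by
  funext s
  ext y
  rw [mem_run, mem_asm]

lemma asm_run {E : ℕ} (hE : 0 < E) (S : Finset ℕ) : asm (run S : Fin E → Finset ℕ) = S := by
  ext x
  obtain ⟨s, y, rfl⟩ := exists_runner hE x
  rw [mem_asm, mem_run]

lemma asm_injective {E : ℕ} : Function.Injective (asm : (Fin E → Finset ℕ) → Finset ℕ) :=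
  Function.LeftInverse.injective run_asm

lemma sum_asm {E : ℕ} (T : Fin E → Finset ℕ) (f : ℕ → ℕ) :
    ∑ x ∈ asm T, f x = ∑ s, ∑ y ∈ T s, f (E * y + s) := by
  rw [asm, Finset.sum_image, Finset.sum_sigma]
  rintro ⟨s, y⟩ - ⟨t, z⟩ - h
  obtain ⟨rfl, rfl⟩ := runner_inj h
  rfl

lemma card_asm {E : ℕ} (T : Fin E → Finset ℕ) : (asm T).card = ∑ s, (T s).card := by
  simp only [Finset.card_eq_sum_ones]
  exact sum_asm T (fun _ => 1)

lemma wt_asm {E : ℕ} (T : Fin E → Finset ℕ) :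
    wt (asm T) = E * ∑ s, wt (T s) + wt (asm (fun s => Finset.range (T s).card)) := by
  have h1 := wt_add (asm T)
  have h2 := wt_add (asm (fun s => Finset.range (T s).card))
  rw [sum_asm T (fun x => x)] at h1
  rw [sum_asm _ (fun x => x), card_asm] at h2
  rw [card_asm] at h1
  simp only [Finset.card_range] at h2
  have h3 : ∑ s : Fin E, ∑ y ∈ T s, (E * y + (s : ℕ)) = E * ∑ s, wt (T s) +
      ∑ s : Fin E, ∑ y ∈ Finset.range (T s).card, (E * y + (s : ℕ)) := by
    rw [Finset.mul_sum, ← Finset.sum_add_distrib]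
    refine Finset.sum_congr rfl fun s _ => ?_
    rw [Finset.sum_add_distrib, Finset.sum_add_distrib, ← Finset.mul_sum, ← Finset.mul_sum,
      ← wt_add (T s)]
    simp
    ring
  omega

lemma wt_eq_run {E : ℕ} (hE : 0 < E) (S : Finset ℕ) :
    wt S = E * ∑ s : Fin E, wt (run S s) + wt (coreB E S) := by
  conv_lhs => rw [← asm_run hE S, wt_asm]
  rfl

lemma coreB_asm {E : ℕ} (T : Fin E → Finset ℕ) :
    coreB E (asm T) = asm (fun s => Finset.range (T s).card) := by
  rw [coreB, run_asm]

lemma mem_mvs_asm {E f y : ℕ} {T : Fin E → Finset ℕ} {s : Fin E} :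
    E * y + s ∈ mvs (E * f) (asm T) ↔ y ∈ mvs f (T s) := by
  rw [mem_mvs, mem_mvs, mem_asm]
  refine and_congr_right fun _ => ?_
  have h1 : E * f ≤ E * y + s ↔ f ≤ y := by
    constructor
    · intro h
      by_contra hlt
      have h2 : E * (y + 1) ≤ E * f := Nat.mul_le_mul_left E (by omega)
      have := s.isLt
      rw [mul_add] at h2
      omega
    · intro h
      have := Nat.mul_le_mul_left E h
      omega
  rw [h1]
  refine and_congr_right fun h => ?_
  have h2 : E * y + s - E * f = E * (y - f) + s := by
    have := Nat.mul_le_mul_left E h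
    rw [Nat.mul_sub]
    omega
  rw [h2, mem_asm]

lemma mv_asm {E f y : ℕ} {T : Fin E → Finset ℕ} {s : Fin E} (h : y ∈ mvs f (T s)) :
    mv (E * f) (E * y + s) (asm T) = asm (Function.update T s (mv f y (T s))) := by
  rw [mem_mvs] at h
  have h2 : E * y + s - E * f = E * (y - f) + s := by
    have := Nat.mul_le_mul_left E h.2.1
    rw [Nat.mul_sub]
    omega
  ext x
  obtain ⟨t, z, rfl⟩ := exists_runner s.pos x
  rw [mem_mv, mem_asm, mem_asm, h2]
  by_cases hst : t = s
  · subst hst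
    rw [Function.update_self, mem_mv]
    have h3 : ∀ w, E * z + (t : ℕ) = E * w + t ↔ z = w := fun w =>
      ⟨fun h => (runner_inj h).2, fun h => by rw [h]⟩
    rw [h3, Ne, h3]
  · rw [Function.update_of_ne hst]
    constructor
    · rintro (h3 | h3)
      · exact absurd (runner_inj h3).1 hst
      · exact h3.2
    · intro h3
      exact Or.inr ⟨fun h4 => hst (runner_inj h4).1, h3⟩

lemma sum_mvs_asm {E : ℕ} (hE : 0 < E) (f : ℕ) (T : Fin E → Finset ℕ) (g : Finset ℕ → ZMod 2) :
    ∑ x ∈ mvs (E * f) (asm T), g (mv (E * f) x (asm T)) =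
      ∑ s, ∑ y ∈ mvs f (T s), g (asm (Function.update T s (mv f y (T s)))) := by
  rw [Finset.sum_sigma' Finset.univ (fun s => mvs f (T s))
    (fun s y => g (asm (Function.update T s (mv f y (T s)))))]
  symm
  refine Finset.sum_bij (fun z _ => E * z.2 + z.1) ?_ ?_ ?_ ?_
  · rintro ⟨s, y⟩ h
    rw [mem_mvs_asm]
    exact (Finset.mem_sigma.1 h).2
  · rintro ⟨s, y⟩ - ⟨t, z⟩ - h
    obtain ⟨rfl, rfl⟩ := runner_inj h
    rfl
  · intro x hx
    obtain ⟨s, y, rfl⟩ := exists_runner hE x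
    exact ⟨⟨s, y⟩, Finset.mem_sigma.2 ⟨Finset.mem_univ _, mem_mvs_asm.1 hx⟩, rfl⟩
  · rintro ⟨s, y⟩ h
    rw [mv_asm (Finset.mem_sigma.1 h).2]

/-- The positions of the nonzero binary digits of `n`. -/
def bits (n : ℕ) : Finset ℕ := n.bitIndices.toFinset

lemma bits_sum (A : Finset ℕ) : bits (∑ i ∈ A, 2 ^ i) = A :=
  Finset.toFinset_bitIndices_sum_two_pow A

lemma sum_bits (n : ℕ) : ∑ i ∈ bits n, 2 ^ i = n := Finset.sum_toFinset_bitIndices_two_pow n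

lemma two_pow_le_of_mem_bits {i n : ℕ} (h : i ∈ bits n) : 2 ^ i ≤ n :=
  Nat.two_pow_le_of_mem_bitIndices (List.mem_toFinset.1 h)

lemma sum_range_two_pow (b : ℕ) : ∑ i ∈ Finset.range b, 2 ^ i < 2 ^ b := by
  induction b with
  | zero => simp
  | succ b ih => rw [Finset.sum_range_succ, pow_succ]; omega

lemma lt_two_pow_of_bits {n b : ℕ} (h : ∀ i ∈ bits n, i < b) : n < 2 ^ b := by
  rw [← sum_bits n]
  refine lt_of_le_of_lt (Finset.sum_le_sum_of_subset fun i hi => ?_) (sum_range_two_pow b)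
  exact Finset.mem_range.2 (h i hi)

lemma top_mem_bits {v b : ℕ} (h1 : 2 ^ b ≤ v) (h2 : v < 2 ^ (b + 1)) : b ∈ bits v := by
  by_contra h
  refine absurd (lt_two_pow_of_bits (n := v) (b := b) fun i hi => ?_) (by omega)
  have h3 := (Nat.pow_lt_pow_iff_right (by norm_num)).1
    ((two_pow_le_of_mem_bits hi).trans_lt h2)
  have h4 : i ≠ b := fun h' => h (h' ▸ hi)
  omega

lemma bits_sub_mem {v b : ℕ} (h : b ∈ bits v) : bits (v - 2 ^ b) = (bits v).erase b := by
  rw [← bits_sum ((bits v).erase b)]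
  congr 1
  have h1 := Finset.add_sum_erase (bits v) (fun i => 2 ^ i) h
  rw [sum_bits] at h1
  omega

lemma sum_Ico_two_pow {j l : ℕ} (h : j ≤ l) : ∑ i ∈ Finset.Ico j l, 2 ^ i + 2 ^ j = 2 ^ l := by
  induction l, h using Nat.le_induction with
  | base => simp
  | succ l h ih => rw [Finset.sum_Ico_succ_top h, pow_succ]; omega

lemma bits_sub_low {v j l : ℕ} (hjl : j ≤ l) (hl : l ∈ bits v)
    (hmin : ∀ i ∈ bits v, j ≤ i → l ≤ i) :
    bits (v - 2 ^ j) = (bits v).erase l ∪ Finset.Ico j l := by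
  rw [← bits_sum ((bits v).erase l ∪ Finset.Ico j l)]
  congr 1
  rw [Finset.sum_union]
  · have h1 := Finset.add_sum_erase (bits v) (fun i => 2 ^ i) hl
    have h2 := sum_Ico_two_pow hjl
    rw [sum_bits] at h1
    omega
  · rw [Finset.disjoint_left]
    intro i hi hi'
    rw [Finset.mem_Ico] at hi'
    have := hmin i (Finset.mem_of_mem_erase hi) hi'.1
    omega

/-- The binary digits of the members of the family `v` are pairwise disjoint. -/
def DigitsDisjoint {ι : Type*} (v : ι → ℕ) : Prop :=
  ∀ s t, s ≠ t → Disjoint (bits (v s)) (bits (v t))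

lemma DigitsDisjoint.eq_of_mem {ι : Type*} {v : ι → ℕ} (h : DigitsDisjoint v) {s t : ι} {i : ℕ}
    (hs : i ∈ bits (v s)) (ht : i ∈ bits (v t)) : s = t := by
  by_contra hst
  exact Finset.disjoint_left.1 (h s t hst) hs ht

lemma DigitsDisjoint.bits_sum {ι : Type*} [Fintype ι] {v : ι → ℕ} (h : DigitsDisjoint v) :
    bits (∑ s, v s) = Finset.univ.biUnion fun s => bits (v s) := by
  rw [← OddSym.bits_sum (Finset.univ.biUnion fun s => bits (v s)), Finset.sum_biUnion]
  · simp only [sum_bits]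
  · intro s _ t _ hst
    exact h s t hst

lemma DigitsDisjoint.mem_bits_sum {ι : Type*} [Fintype ι] {v : ι → ℕ} (h : DigitsDisjoint v)
    {i : ℕ} : i ∈ bits (∑ s, v s) ↔ ∃ s, i ∈ bits (v s) := by
  rw [h.bits_sum]
  simp

lemma le_sum_univ {ι : Type*} [Fintype ι] (v : ι → ℕ) (s : ι) : v s ≤ ∑ t, v t :=
  Finset.single_le_sum (f := v) (fun _ _ => Nat.zero_le _) (Finset.mem_univ s)

lemma add_le_sum_univ {ι : Type*} [Fintype ι] (v : ι → ℕ) {s t : ι} (h : s ≠ t) :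
    v s + v t ≤ ∑ u, v u := by
  rw [← Finset.sum_pair h]
  exact Finset.sum_le_sum_of_subset (Finset.subset_univ _)

lemma digitsDisjoint_update_top {ι : Type*} [Fintype ι] [DecidableEq ι] {v : ι → ℕ} {b : ℕ}
    (hv : ∑ s, v s < 2 ^ (b + 1)) {s : ι} (hs : 2 ^ b ≤ v s) :
    DigitsDisjoint (Function.update v s (v s - 2 ^ b)) ↔ DigitsDisjoint v := by
  have hbs : b ∈ bits (v s) := top_mem_bits hs ((le_sum_univ v s).trans_lt hv)
  have hbt : ∀ t, b ∈ bits (v t) → t = s := by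
    intro t ht
    by_contra hne
    have h1 := add_le_sum_univ v hne
    have h2 := two_pow_le_of_mem_bits ht
    rw [pow_succ] at hv
    omega
  have key : ∀ t, bits (Function.update v s (v s - 2 ^ b) t) = (bits (v t)).erase b := by
    intro t
    by_cases h : t = s
    · subst h
      rw [Function.update_self, bits_sub_mem hbs]
    · rw [Function.update_of_ne h, Finset.erase_eq_of_notMem fun h' => h (hbt t h')]
  constructor
  · intro h t u htu
    rw [Finset.disjoint_left]
    intro i hi hi'
    by_cases hib : i = b
    · subst hib
      exact htu ((hbt t hi).trans (hbt u hi').symm)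
    · refine htu (h.eq_of_mem (i := i) ?_ ?_) <;> rw [key, Finset.mem_erase]
      · exact ⟨hib, hi⟩
      · exact ⟨hib, hi'⟩
  · intro h t u htu
    rw [key, key]
    exact (h t u htu).mono (Finset.erase_subset _ _) (Finset.erase_subset _ _)

lemma digitsDisjoint_update_low {ι : Type*} [Fintype ι] [DecidableEq ι] {v : ι → ℕ} (hv : DigitsDisjoint v)
    {j l : ℕ} {σ : ι} (hjl : j ≤ l) (hl : l ∈ bits (v σ))
    (hmin : ∀ i ∈ bits (∑ s, v s), j ≤ i → l ≤ i) {s : ι} (hs : 2 ^ j ≤ v s) :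
    DigitsDisjoint (Function.update v s (v s - 2 ^ j)) ↔ s = σ := by
  have hmin' : ∀ t, ∀ i ∈ bits (v t), j ≤ i → l ≤ i := fun t i hi =>
    hmin i (hv.mem_bits_sum.2 ⟨t, hi⟩)
  constructor
  · intro h
    by_contra hne
    have hex : ∃ i, i ∈ bits (v s) ∧ j ≤ i := by
      by_contra hno
      push Not at hno
      have := lt_two_pow_of_bits hno
      omega
    obtain ⟨h1, h2⟩ := Nat.find_spec hex
    have h3 := fun c => Nat.find_min hex (m := c)
    set l' := Nat.find hex
    have hbits := bits_sub_low h2 h1 fun i hi hji => by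
      by_contra hlt
      exact h3 i (by omega) ⟨hi, hji⟩
    have hll : l ≤ l' := hmin' s l' h1 h2
    have hne' : l ≠ l' := fun h' => hne (hv.eq_of_mem (h' ▸ h1 : l ∈ bits (v s)) hl)
    refine hne (h.eq_of_mem (i := l) ?_ ?_)
    · rw [Function.update_self, hbits, Finset.mem_union, Finset.mem_Ico]
      exact Or.inr ⟨hjl, by omega⟩
    · rw [Function.update_of_ne (fun h' => hne h'.symm)]
      exact hl
  · rintro rfl
    have hbits := bits_sub_low hjl hl (hmin' s)
    have key : ∀ t, t ≠ s → Disjoint (bits (v s - 2 ^ j)) (bits (v t)) := by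
      intro t ht
      rw [Finset.disjoint_left, hbits]
      intro i hi hi'
      rw [Finset.mem_union, Finset.mem_Ico] at hi
      rcases hi with hi | hi
      · exact ht (hv.eq_of_mem hi' (Finset.mem_of_mem_erase hi))
      · have := hmin' t i hi' hi.1
        omega
    intro t u htu
    by_cases ht : t = s
    · subst ht
      rw [Function.update_self, Function.update_of_ne htu.symm]
      exact key u htu.symm
    · rw [Function.update_of_ne ht]
      by_cases hu : u = s
      · subst hu
        rw [Function.update_self]
        exact (key t ht).symm
      · rw [Function.update_of_ne hu]
        exact hv t u htu

/-- The bead set with the same number of beads on each runner, all pushed up. -/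
def coreT {E : ℕ} (T : Fin E → Finset ℕ) : Finset ℕ := asm fun s => Finset.range (T s).card

lemma coreT_update {E f y : ℕ} {T : Fin E → Finset ℕ} {s : Fin E} (h : y ∈ mvs f (T s)) :
    coreT (Function.update T s (mv f y (T s))) = coreT T := by
  unfold coreT
  congr 1
  funext t
  by_cases ht : t = s
  · subst ht
    rw [Function.update_self, mv_card h]
  · rw [Function.update_of_ne ht]

lemma wt_update {E f y : ℕ} {T : Fin E → Finset ℕ} {s : Fin E} (h : y ∈ mvs f (T s)) :
    (fun t => wt (Function.update T s (mv f y (T s)) t)) =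
      Function.update (fun t => wt (T t)) s (wt (T s) - f) := by
  funext t
  by_cases ht : t = s
  · subst ht
    have := mv_wt h
    rw [Function.update_self, Function.update_self]
    omega
  · rw [Function.update_of_ne ht, Function.update_of_ne ht]

lemma prod_par_update {E : ℕ} (T : Fin E → Finset ℕ) (s : Fin E) (X : Finset ℕ) :
    ∏ t, par (Function.update T s X t) =
      par X * ∏ t ∈ Finset.univ \ {s}, par (T t) := by
  have h : (fun t => par (Function.update T s X t)) =
      Function.update (fun t => par (T t)) s (par X) := by
    funext t
    by_cases ht : t = s
    · subst ht; rw [Function.update_self, Function.update_self]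
    · rw [Function.update_of_ne ht, Function.update_of_ne ht]
  rw [h, Finset.prod_update_of_mem (Finset.mem_univ s)]

lemma par_asm (k : ℕ) (T : Fin (2 ^ k) → Finset ℕ) :
    par (asm T) = if wt (coreT T) < 2 ^ k ∧ DigitsDisjoint (fun s => wt (T s)) then
      par (coreT T) * ∏ s, par (T s) else 0 := by
  induction hn : wt (asm T) using Nat.strong_induction_on generalizing T with
  | _ n ih =>
  have hwt : wt (asm T) = 2 ^ k * ∑ s, wt (T s) + wt (coreT T) := wt_asm T
  have hE : 0 < 2 ^ k := by positivity
  rcases lt_or_ge (wt (asm T)) (2 ^ k) with hlt | hge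
  · have h0 : ∑ s, wt (T s) = 0 := by
      by_contra h
      have := Nat.mul_le_mul_left (2 ^ k) (Nat.one_le_iff_ne_zero.2 h)
      omega
    have h1 : ∀ s, wt (T s) = 0 := fun s => Finset.sum_eq_zero_iff.1 h0 s (Finset.mem_univ s)
    have h2 : coreT T = asm T := by
      unfold coreT
      congr 1
      funext s
      exact (eq_range_of_wt (h1 s)).symm
    have h3 : DigitsDisjoint (fun s => wt (T s)) := by
      intro s t _
      simp [h1, bits]
    rw [if_pos ⟨by omega, h3⟩, h2, Finset.prod_congr rfl fun s _ => par_of_wt (h1 s)]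
    simp
  · obtain ⟨a, ha⟩ : ∃ a, a = Nat.log 2 (wt (asm T)) := ⟨_, rfl⟩
    have hle : 2 ^ a ≤ wt (asm T) := ha ▸ Nat.pow_log_le_self 2 (by omega)
    have hlt : wt (asm T) < 2 ^ (a + 1) := ha ▸ Nat.lt_pow_succ_log_self (by norm_num) _
    have hka : k ≤ a := by
      have := (Nat.pow_lt_pow_iff_right (a := 2) (by norm_num)).1 (hge.trans_lt hlt)
      omega
    obtain ⟨b, rfl⟩ := Nat.exists_eq_add_of_le hka
    rw [par_hook _ hle, pow_add, sum_mvs_asm hE]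
    have hterm : ∀ s, ∀ y ∈ mvs (2 ^ b) (T s),
        par (asm (Function.update T s (mv (2 ^ b) y (T s)))) =
          if wt (coreT T) < 2 ^ k ∧
            DigitsDisjoint (Function.update (fun t => wt (T t)) s (wt (T s) - 2 ^ b)) then
          par (coreT T) * (par (mv (2 ^ b) y (T s)) * ∏ t ∈ Finset.univ \ {s}, par (T t))
          else 0 := by
      intro s y hy
      have h1 : wt (asm (Function.update T s (mv (2 ^ b) y (T s)))) < n := by
        have h2 := mv_wt (mem_mvs_asm.2 hy)
        rw [mv_asm hy] at h2
        have : 0 < 2 ^ k * 2 ^ b := by positivity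
        omega
      rw [ih _ h1 _ rfl, coreT_update hy, wt_update hy, prod_par_update]
    by_cases hc : wt (coreT T) < 2 ^ k
    · have hw1 : ∑ s, wt (T s) < 2 ^ (b + 1) := by
        rw [add_assoc, pow_add] at hlt
        exact Nat.lt_of_mul_lt_mul_left (a := 2 ^ k) (by omega)
      have hw2 : 2 ^ b ≤ ∑ s, wt (T s) := by
        rw [pow_add] at hle
        have : 2 ^ k * 2 ^ b < 2 ^ k * (∑ s, wt (T s) + 1) := by rw [mul_add]; omega
        have := Nat.lt_of_mul_lt_mul_left this
        omega
      by_cases hex : ∃ s, 2 ^ b ≤ wt (T s)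
      · obtain ⟨s, hs⟩ := hex
        have hdd : DigitsDisjoint (Function.update (fun t => wt (T t)) s (wt (T s) - 2 ^ b)) ↔
            DigitsDisjoint (fun t => wt (T t)) := 
              digitsDisjoint_update_top (v := fun t => wt (T t)) hw1 hs
        rw [Finset.sum_eq_single s]
        · rw [Finset.sum_congr rfl (hterm s), hdd]
          split_ifs with hd
          · rw [← Finset.mul_sum, ← Finset.sum_mul, ← par_hook b hs,
              Finset.prod_eq_mul_prod_sdiff_singleton_of_mem (Finset.mem_univ s)]
          · simp
        · intro t _ hts
          have h1 := add_le_sum_univ (fun t => wt (T t)) hts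
          rw [mvs_eq_empty, Finset.sum_empty]
          rw [pow_succ] at hw1
          omega
        · intro h
          exact absurd (Finset.mem_univ s) h
      · rw [if_neg]
        · refine Finset.sum_eq_zero fun s _ => ?_
          push Not at hex
          rw [mvs_eq_empty (hex s), Finset.sum_empty]
        · rintro ⟨-, hd⟩
          obtain ⟨s, hs⟩ := hd.mem_bits_sum.1 (top_mem_bits hw2 hw1)
          exact hex ⟨s, two_pow_le_of_mem_bits hs⟩
    · rw [if_neg fun h => hc h.1]
      refine Finset.sum_eq_zero fun s _ => Finset.sum_eq_zero fun y hy => ?_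
      rw [hterm s y hy, if_neg fun h => hc h.1]

lemma mul_eq_one_iff_zmod_two {x y : ZMod 2} : x * y = 1 ↔ x = 1 ∧ y = 1 := by
  revert x y
  decide

lemma prod_eq_one_iff_zmod_two {ι : Type*} (A : Finset ι) (f : ι → ZMod 2) :
    ∏ i ∈ A, f i = 1 ↔ ∀ i ∈ A, f i = 1 := by
  induction A using Finset.induction_on with
  | empty => simp
  | insert a A ha ih => rw [Finset.prod_insert ha, mul_eq_one_iff_zmod_two, ih]; simp

lemma par_asm_eq_one {k : ℕ} {T : Fin (2 ^ k) → Finset ℕ} :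
    par (asm T) = 1 ↔ wt (coreT T) < 2 ^ k ∧ par (coreT T) = 1 ∧
      DigitsDisjoint (fun s => wt (T s)) ∧ ∀ s, par (T s) = 1 := by
  rw [par_asm]
  split_ifs with h
  · rw [mul_eq_one_iff_zmod_two, prod_eq_one_iff_zmod_two]
    simp [h.1, h.2]
  · constructor
    · intro h'
      exact absurd h' (by decide)
    · rintro ⟨h1, -, h2, -⟩
      exact absurd ⟨h1, h2⟩ h

/-- The odd bead sets obtained by removing a hook from an odd one, in terms of runners. -/
lemma par_update_eq_one {k j l y : ℕ} {T : Fin (2 ^ k) → Finset ℕ} (hT : par (asm T) = 1)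
    {σ s : Fin (2 ^ k)} (hjl : j ≤ l) (hl : l ∈ bits (wt (T σ)))
    (hmin : ∀ i ∈ bits (∑ s, wt (T s)), j ≤ i → l ≤ i) (hy : y ∈ mvs (2 ^ j) (T s)) :
    par (asm (Function.update T s (mv (2 ^ j) y (T s)))) = 1 ↔
      s = σ ∧ par (mv (2 ^ j) y (T s)) = 1 := by
  rw [par_asm_eq_one] at hT
  obtain ⟨h1, h2, h3, h4⟩ := hT
  have h5 := mv_wt hy
  have hdd : DigitsDisjoint (Function.update (fun t => wt (T t)) s (wt (T s) - 2 ^ j)) ↔ s = σ :=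
    digitsDisjoint_update_low (v := fun t => wt (T t)) h3 hjl hl hmin
      (show 2 ^ j ≤ wt (T s) by omega)
  rw [par_asm_eq_one, coreT_update hy, wt_update hy, hdd]
  constructor
  · rintro ⟨-, -, h6, h7⟩
    refine ⟨h6, ?_⟩
    have := h7 s
    rwa [Function.update_self] at this
  · rintro ⟨h6, h7⟩
    refine ⟨h1, h2, h6, fun t => ?_⟩
    by_cases ht : t = s
    · subst ht; rwa [Function.update_self]
    · rw [Function.update_of_ne ht]; exact h4 t

lemma exists_min_bit {w j : ℕ} (h : 2 ^ j ≤ w) :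
    ∃ l ∈ bits w, j ≤ l ∧ ∀ i ∈ bits w, j ≤ i → l ≤ i := by
  have hex : ∃ i, i ∈ bits w ∧ j ≤ i := by
    by_contra hno
    push Not at hno
    have := lt_two_pow_of_bits hno
    omega
  refine ⟨Nat.find hex, (Nat.find_spec hex).1, (Nat.find_spec hex).2, fun i hi hji => ?_⟩
  exact Nat.find_min' hex ⟨hi, hji⟩

/-- Uniqueness of the odd bead set obtained by removing a `2 ^ k`-hook. -/
lemma odd_mv_unique (k : ℕ) {S : Finset ℕ} (hS : par S = 1) {x y : ℕ} (hx : x ∈ mvs (2 ^ k) S)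
    (hy : y ∈ mvs (2 ^ k) S) (hxo : par (mv (2 ^ k) x S) = 1) (hyo : par (mv (2 ^ k) y S) = 1) :
    x = y := by
  have hE : 0 < 2 ^ k := by positivity
  obtain ⟨T, rfl⟩ : ∃ T : Fin (2 ^ k) → Finset ℕ, S = asm T := ⟨run S, (asm_run hE S).symm⟩
  have hwt : wt (asm T) = 2 ^ k * ∑ s, wt (T s) + wt (coreT T) := wt_asm T
  have hcore := (par_asm_eq_one.1 hS).1
  have hle := mv_wt hx
  have hw : 2 ^ 0 ≤ ∑ s, wt (T s) := by
    rw [pow_zero, Nat.one_le_iff_ne_zero]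
    intro h
    rw [h] at hwt
    omega
  obtain ⟨l, hl, hjl, hmin⟩ := exists_min_bit hw
  have hd := (par_asm_eq_one.1 hS).2.2.1
  obtain ⟨σ, hσ⟩ := hd.mem_bits_sum.1 hl
  obtain ⟨s, x, rfl⟩ := exists_runner hE x
  obtain ⟨t, y, rfl⟩ := exists_runner hE y
  have key : ∀ (s : Fin (2 ^ k)) (x : ℕ), 2 ^ k * x + s ∈ mvs (2 ^ k) (asm T) →
      par (mv (2 ^ k) (2 ^ k * x + s) (asm T)) = 1 → x ∈ mvs (2 ^ 0) (T s) ∧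
        par (asm (Function.update T s (mv (2 ^ 0) x (T s)))) = 1 := by
    intro s x hx hxo
    have h1 : x ∈ mvs (2 ^ 0) (T s) := by
      rw [← mem_mvs_asm, pow_zero, mul_one]
      exact hx
    refine ⟨h1, ?_⟩
    rw [← mv_asm h1, pow_zero, mul_one]
    exact hxo
  obtain ⟨hx, hxo⟩ := key s x hx hxo
  obtain ⟨hy, hyo⟩ := key t y hy hyo
  obtain ⟨rfl, hxo⟩ := (par_update_eq_one (j := 0) hS hjl hσ hmin hx).1 hxo
  obtain ⟨rfl, hyo⟩ := (par_update_eq_one (j := 0) hS hjl hσ hmin hy).1 hyo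
  rw [odd_mv_one_unique ((par_asm_eq_one.1 hS).2.2.2 t) hx hy hxo hyo]

/-- Removing two `e`-hooks from `S`, with odd results, amounts to removing an `f`-hook. -/
def HookSquare (e f : ℕ) (S : Finset ℕ) : Prop :=
  ∃ x ∈ mvs e S, ∃ y ∈ mvs e (mv e x S), ∃ z ∈ mvs f S, par (mv e x S) = 1 ∧
    par (mv e y (mv e x S)) = 1 ∧ mv e y (mv e x S) = mv f z S

lemma mv_ne {f y : ℕ} {X : Finset ℕ} (h : y ∈ mvs f X) : mv f y X ≠ X := by
  intro h'
  have h1 := (mem_mvs.1 h).2.2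
  rw [← h'] at h1
  exact h1 (mem_mv.2 (Or.inl rfl))

lemma hookSquare_asm {k l₀ l₁ : ℕ} {T : Fin (2 ^ k) → Finset ℕ} (hT : par (asm T) = 1)
    {σ₀ σ₁ : Fin (2 ^ k)} (hl₀ : l₀ ∈ bits (wt (T σ₀)))
    (hmin₀ : ∀ i ∈ bits (∑ s, wt (T s)), l₀ ≤ i) (hl₁ : l₁ ∈ bits (wt (T σ₁))) (h1l : 1 ≤ l₁)
    (hmin₁ : ∀ i ∈ bits (∑ s, wt (T s)), 1 ≤ i → l₁ ≤ i) :
    HookSquare (2 ^ k * 1) (2 ^ k * 2) (asm T) ↔ σ₀ = σ₁ ∧ HookSquare 1 2 (T σ₀) := by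
  have hone : ∀ {s y}, y ∈ mvs 1 (T s) →
      (par (asm (Function.update T s (mv 1 y (T s)))) = 1 ↔
        s = σ₀ ∧ par (mv 1 y (T s)) = 1) := fun {s y} hy =>
    par_update_eq_one (j := 0) hT (Nat.zero_le _) hl₀ (fun i hi _ => hmin₀ i hi) hy
  have htwo : ∀ {s y}, y ∈ mvs 2 (T s) →
      (par (asm (Function.update T s (mv 2 y (T s)))) = 1 ↔
        s = σ₁ ∧ par (mv 2 y (T s)) = 1) := fun {s y} hy =>
    par_update_eq_one (j := 1) hT h1l hl₁ hmin₁ hy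
  constructor
  · rintro ⟨x, hx, y, hy, z, hz, hxo, hyo, hyz⟩
    obtain ⟨s, x, rfl⟩ := exists_runner σ₀.pos x
    rw [mem_mvs_asm] at hx
    rw [mv_asm hx] at hxo hyo hyz hy
    obtain ⟨rfl, hxo⟩ := (hone hx).1 hxo
    obtain ⟨t, y, rfl⟩ := exists_runner s.pos y
    rw [mem_mvs_asm] at hy
    rw [mv_asm hy] at hyo hyz
    obtain ⟨u, z, rfl⟩ := exists_runner s.pos z
    rw [mem_mvs_asm] at hz
    rw [mv_asm hz] at hyz
    rw [hyz] at hyo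
    obtain ⟨rfl, hzo⟩ := (htwo hz).1 hyo
    have hfun := asm_injective hyz
    have hts : t = s := by
      by_contra hts
      rw [Function.update_of_ne hts] at hfun hy
      have h1 := congrFun hfun s
      have h2 := congrFun hfun t
      rw [Function.update_of_ne (fun h => hts h.symm), Function.update_self] at h1
      rw [Function.update_self] at h2
      have hsu : s = u := by
        by_contra hsu
        rw [Function.update_of_ne hsu] at h1
        exact mv_ne hx h1
      rw [Function.update_of_ne (fun h => hts (h.trans hsu.symm))] at h2
      exact mv_ne hy h2
    subst hts
    rw [Function.update_self, Function.update_idem] at hfun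
    rw [Function.update_self] at hy
    have h1 := congrFun hfun t
    rw [Function.update_self] at h1
    have htu : t = u := by
      by_contra htu
      rw [Function.update_of_ne htu] at h1
      have h2 := mv_wt hx
      have h3 := mv_wt hy
      rw [h1] at h3
      omega
    subst htu
    rw [Function.update_self] at h1
    exact ⟨rfl, x, hx, y, hy, z, hz, hxo, h1 ▸ hzo, h1⟩
  · rintro ⟨rfl, x, hx, y, hy, z, hz, hxo, hyo, hyz⟩
    have hy' : y ∈ mvs 1 (Function.update T σ₀ (mv 1 x (T σ₀)) σ₀) := by
      rwa [Function.update_self]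
    have heq : mv (2 ^ k * 1) (2 ^ k * y + σ₀) (mv (2 ^ k * 1) (2 ^ k * x + σ₀) (asm T)) =
        mv (2 ^ k * 2) (2 ^ k * z + σ₀) (asm T) := by
      rw [mv_asm hx, mv_asm hy', mv_asm hz, Function.update_self, Function.update_idem, hyz]
    refine ⟨2 ^ k * x + σ₀, mem_mvs_asm.2 hx, 2 ^ k * y + σ₀, ?_, 2 ^ k * z + σ₀,
      mem_mvs_asm.2 hz, ?_, ?_, heq⟩
    · rw [mv_asm hx]
      exact mem_mvs_asm.2 hy'
    · rw [mv_asm hx]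
      exact (hone hx).2 ⟨rfl, hxo⟩
    · rw [heq, mv_asm hz]
      exact (htwo hz).2 ⟨rfl, hyz ▸ hyo⟩

lemma partOfBeta_insert {S : Finset ℕ} {a : ℕ} (h : ∀ x ∈ S, x < a) :
    partOfBeta (insert a S) =
      if 0 < a - S.card then (a - S.card) ::ₘ partOfBeta S else partOfBeta S := by
  have ha : a ∉ S := fun h' => lt_irrefl _ (h a h')
  have h1 : ∀ b ∈ S.val, b - ((insert a S).filter (fun x => x < b)).card =
      b - (S.filter (fun x => x < b)).card := by
    intro b hb
    rw [Finset.filter_insert, if_neg (by have := h b hb; omega)]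
  have h2 : (insert a S).filter (fun x => x < a) = S := by
    rw [Finset.filter_insert, if_neg (lt_irrefl a), Finset.filter_true_of_mem h]
  rw [partOfBeta, Finset.insert_val_of_notMem ha, Multiset.map_cons, h2, Multiset.map_congr rfl h1,
    Multiset.filter_cons, partOfBeta]
  split_ifs <;> simp

lemma card_partOfBeta_le (S : Finset ℕ) : Multiset.card (partOfBeta S) ≤ S.card := by
  rw [partOfBeta]
  refine (Multiset.card_le_card (Multiset.filter_le _ _)).trans ?_
  simp

lemma partOfBeta_eq_zero {S : Finset ℕ} (h : wt S = 0) : partOfBeta S = 0 := by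
  refine Multiset.eq_zero_of_forall_notMem fun x hx => ?_
  have h1 := partOfBeta_pos S x hx
  have h2 := Multiset.le_sum_of_mem hx
  rw [partOfBeta_sum] at h2
  omega

lemma descList_cons {lam : Multiset ℕ} {p : ℕ} (h : ∀ x ∈ lam, x ≤ p) :
    descList (p ::ₘ lam) = p :: descList lam := by
  have h1 : (p ::ₘ lam).sort (· ≤ ·) = lam.sort (· ≤ ·) ++ [p] := by
    refine List.Perm.eq_of_pairwise' (r := (· ≤ ·)) (Multiset.pairwise_sort _ _) ?_ ?_
    · rw [List.pairwise_append]
      refine ⟨Multiset.pairwise_sort _ _, List.pairwise_singleton _ _, ?_⟩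
      intro x hx y hy
      rw [List.mem_singleton] at hy
      subst hy
      exact h x ((Multiset.mem_sort _).1 hx)
    · rw [← Multiset.coe_eq_coe, Multiset.sort_eq, ← Multiset.coe_add, Multiset.sort_eq,
        Multiset.coe_singleton, ← Multiset.singleton_add, add_comm]
  rw [descList, h1, List.reverse_append, descList]
  rfl

lemma betaSet_zero (m : ℕ) : betaSet 0 m = Finset.range m := by
  ext x
  simp only [betaSet, descList, Multiset.sort_zero, Finset.mem_image, Finset.mem_range,
    List.reverse_nil, List.getD_nil, zero_add]
  constructor
  · rintro ⟨i, h1, h2⟩; omega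
  · intro h; exact ⟨m - 1 - x, by omega, by omega⟩

lemma betaSet_cons {lam : Multiset ℕ} {p : ℕ} (h : ∀ x ∈ lam, x ≤ p) (m : ℕ) :
    betaSet (p ::ₘ lam) (m + 1) = insert (p + m) (betaSet lam m) := by
  rw [betaSet, descList_cons h, Finset.range_add_one', Finset.image_insert, betaSet]
  congr 1
  ext x
  simp only [Finset.mem_image, Finset.mem_map, exists_exists_and_eq_and, Finset.mem_range]
  refine exists_congr fun i => and_congr_right fun hi => ?_
  change (p :: descList lam).getD (i + 1) 0 + (m + 1 - 1 - (i + 1)) = x ↔ _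
  rw [show m + 1 - 1 - (i + 1) = m - 1 - i by omega, List.getD_cons_succ]

lemma exists_gap_of_mem_partOfBeta {S : Finset ℕ} {x : ℕ} (hx : x ∈ partOfBeta S) :
    ∃ b ∈ S, gap S b = x := by
  rw [partOfBeta, Multiset.mem_filter, Multiset.mem_map] at hx
  exact hx.1

lemma betaSet_partOfBeta (S : Finset ℕ) : betaSet (partOfBeta S) S.card = S := by
  induction S using Finset.induction_on_max with
  | empty => rw [partOfBeta_eq_zero (by simp [wt]), betaSet_zero]; rfl
  | insert a S h ih =>
    have ha : a ∉ S := fun h' => lt_irrefl _ (h a h')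
    have h2 : (insert a S).filter (fun x => x < a) = S := by
      rw [Finset.filter_insert, if_neg (lt_irrefl a), Finset.filter_true_of_mem h]
    have hgap : ∀ b ∈ insert a S, gap (insert a S) b ≤ a - S.card := by
      intro b hb
      have : b ≤ a := by
        rcases Finset.mem_insert.1 hb with h3 | h3
        · exact h3.le
        · exact (h b h3).le
      have := gap_mono (insert a S) this
      rwa [gap, gap, h2] at this
    have hc : S.card ≤ a := by have := card_filter_lt_le (insert a S) a; rwa [h2] at this
    by_cases h0 : 0 < a - S.card
    · have hp := partOfBeta_insert h
      rw [if_pos h0] at hp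
      rw [hp, Finset.card_insert_of_notMem ha, betaSet_cons, ih, Nat.sub_add_cancel hc]
      intro x hx
      have : x ∈ partOfBeta (insert a S) := by rw [hp]; exact Multiset.mem_cons_of_mem hx
      obtain ⟨b, hb, rfl⟩ := exists_gap_of_mem_partOfBeta this
      exact hgap b hb
    · have hw : wt (insert a S) = 0 := Finset.sum_eq_zero fun b hb => by
        have := hgap b hb; omega
      rw [partOfBeta_eq_zero hw, betaSet_zero, ← eq_range_of_wt hw]

lemma exists_partOfBeta (m : ℕ) : ∀ lam : Multiset ℕ, (∀ x ∈ lam, 0 < x) →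
    Multiset.card lam ≤ m → ∃ S : Finset ℕ, S.card = m ∧ partOfBeta S = lam := by
  induction m with
  | zero =>
    intro lam _ h
    rw [Nat.le_zero, Multiset.card_eq_zero] at h
    exact ⟨∅, rfl, by rw [partOfBeta_eq_zero (by simp [wt]), h]⟩
  | succ m ih =>
    intro lam hpos hc
    by_cases h0 : lam = 0
    · exact ⟨Finset.range (m + 1), by simp, by rw [partOfBeta_eq_zero (wt_range _), h0]⟩
    · have hne : lam.toFinset.Nonempty := by
        obtain ⟨x, hx⟩ := Multiset.exists_mem_of_ne_zero h0
        exact ⟨x, by simpa using hx⟩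
      obtain ⟨p, hp, hmax⟩ := Finset.exists_max_image lam.toFinset id hne
      rw [Multiset.mem_toFinset] at hp
      obtain ⟨lam', rfl⟩ := Multiset.exists_cons_of_mem hp
      obtain ⟨S, hS, hSp⟩ := ih lam' (fun x hx => hpos x (Multiset.mem_cons_of_mem hx))
        (by rw [Multiset.card_cons] at hc; omega)
      have hp0 := hpos p hp
      have hlt : ∀ x ∈ S, x < p + m := by
        intro x hx
        have h1 : (S.filter (fun a => a < x)).card < S.card :=
          Finset.card_lt_card (Finset.filter_ssubset.2 ⟨x, hx, lt_irrefl x⟩)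
        have h2 : gap S x ≤ p := by
          rcases Nat.eq_zero_or_pos (gap S x) with h3 | h3
          · omega
          · refine hmax _ ?_
            rw [Multiset.mem_toFinset, ← hSp]
            refine Multiset.mem_cons_of_mem ?_
            rw [partOfBeta, Multiset.mem_filter, Multiset.mem_map]
            exact ⟨⟨x, hx, rfl⟩, h3⟩
        rw [gap] at h2
        omega
      refine ⟨insert (p + m) S, ?_, ?_⟩
      · rw [Finset.card_insert_of_notMem (fun h' => lt_irrefl _ (hlt _ h')), hS]
      · rw [partOfBeta_insert hlt, hS, Nat.add_sub_cancel, if_pos hp0, hSp]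

lemma partOfBeta_betaSet {lam : Multiset ℕ} {m : ℕ} (hpos : ∀ x ∈ lam, 0 < x)
    (hc : Multiset.card lam ≤ m) : partOfBeta (betaSet lam m) = lam := by
  obtain ⟨S, rfl, rfl⟩ := exists_partOfBeta m lam hpos hc
  rw [betaSet_partOfBeta]

lemma card_betaSet {lam : Multiset ℕ} {m : ℕ} (hpos : ∀ x ∈ lam, 0 < x)
    (hc : Multiset.card lam ≤ m) : (betaSet lam m).card = m := by
  obtain ⟨S, rfl, rfl⟩ := exists_partOfBeta m lam hpos hc
  rw [betaSet_partOfBeta]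

lemma partOfBeta_inj {S T : Finset ℕ} (hc : S.card = T.card) (h : partOfBeta S = partOfBeta T) :
    S = T := by
  rw [← betaSet_partOfBeta S, ← betaSet_partOfBeta T, h, hc]

/-- Shift all beads up by one and put a bead in the new lowest position. -/
def shift (S : Finset ℕ) : Finset ℕ := insert 0 (S.image Nat.succ)

lemma succ_mem_shift {S : Finset ℕ} {x : ℕ} : x + 1 ∈ shift S ↔ x ∈ S := by
  simp [shift]

lemma zero_mem_shift (S : Finset ℕ) : 0 ∈ shift S := by simp [shift]

lemma shift_injective : Function.Injective shift := by
  intro S T h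
  ext x
  rw [← succ_mem_shift, h, succ_mem_shift]

lemma gap_shift (S : Finset ℕ) (b : ℕ) : gap (shift S) (b + 1) = gap S b := by
  have : (shift S).filter (fun a => a < b + 1) = shift (S.filter (fun a => a < b)) := by
    ext x
    rcases x with - | x
    · simp [zero_mem_shift]
    · simp [succ_mem_shift]
  have h0 : 0 ∉ (S.filter (fun a => a < b)).image Nat.succ := by simp
  rw [gap, gap, this, shift, Finset.card_insert_of_notMem h0,
    Finset.card_image_of_injective _ Nat.succ_injective]
  omega

lemma shift_val (S : Finset ℕ) : (shift S).val = 0 ::ₘ S.val.map Nat.succ := by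
  have h0 : 0 ∉ S.image Nat.succ := by simp
  rw [shift, Finset.insert_val_of_notMem h0,
    Finset.image_val_of_injOn Nat.succ_injective.injOn]

lemma card_shift (S : Finset ℕ) : (shift S).card = S.card + 1 := by
  rw [Finset.card_def, shift_val, Multiset.card_cons, Multiset.card_map, Finset.card_def]

lemma partOfBeta_shift (S : Finset ℕ) : partOfBeta (shift S) = partOfBeta S := by
  rw [partOfBeta, shift_val, Multiset.map_cons, Multiset.filter_cons, Multiset.map_map, partOfBeta]
  have h : Multiset.map ((fun b => b - ((shift S).filter (fun a => a < b)).card) ∘ Nat.succ) S.val =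
      S.val.map (fun b => b - (S.filter (fun a => a < b)).card) :=
    Multiset.map_congr rfl fun b _ => gap_shift S b
  rw [h]
  simp

lemma betaSet_succ {lam : Multiset ℕ} {m : ℕ} (hpos : ∀ x ∈ lam, 0 < x)
    (hc : Multiset.card lam ≤ m) : betaSet lam (m + 1) = shift (betaSet lam m) := by
  obtain ⟨S, rfl, rfl⟩ := exists_partOfBeta m lam hpos hc
  rw [betaSet_partOfBeta, ← partOfBeta_shift, ← card_shift, betaSet_partOfBeta]

lemma mem_mvs_shift {e x : ℕ} {S : Finset ℕ} :
    x + 1 ∈ mvs e (shift S) ↔ x ∈ mvs e S := by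
  rw [mem_mvs, mem_mvs, succ_mem_shift]
  refine and_congr_right fun _ => ?_
  constructor
  · rintro ⟨h1, h2⟩
    have : e ≤ x := by
      by_contra h3
      rw [show x + 1 - e = 0 by omega] at h2
      exact h2 (zero_mem_shift S)
    rw [show x + 1 - e = x - e + 1 by omega, succ_mem_shift] at h2
    exact ⟨this, h2⟩
  · rintro ⟨h1, h2⟩
    rw [show x + 1 - e = x - e + 1 by omega, succ_mem_shift]
    exact ⟨by omega, h2⟩

lemma mv_shift {e x : ℕ} {S : Finset ℕ} (h : e ≤ x) :
    mv e (x + 1) (shift S) = shift (mv e x S) := by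
  ext y
  rcases y with - | y
  · simp only [mem_mv, zero_mem_shift, iff_true]
    exact Or.inr ⟨by omega, trivial⟩
  · rw [mem_mv, succ_mem_shift, succ_mem_shift, mem_mv]
    have h1 : y + 1 = x + 1 - e ↔ y = x - e := by omega
    have h2 : y + 1 ≠ x + 1 ↔ y ≠ x := by omega
    rw [h1, h2]

lemma hook_shift_iff {e : ℕ} (he : 0 < e) (S T : Finset ℕ) :
    (∃ x ∈ mvs e (shift S), shift T = mv e x (shift S)) ↔ ∃ x ∈ mvs e S, T = mv e x S := by
  constructor
  · rintro ⟨x, hx, h⟩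
    have h1 := (mem_mvs.1 hx).2.1
    obtain ⟨y, rfl⟩ : ∃ y, x = y + 1 := ⟨x - 1, by omega⟩
    rw [mem_mvs_shift] at hx
    rw [mv_shift (mem_mvs.1 hx).2.1] at h
    exact ⟨y, hx, shift_injective h⟩
  · rintro ⟨x, hx, rfl⟩
    exact ⟨x + 1, (mem_mvs_shift).2 hx, (mv_shift (mem_mvs.1 hx).2.1).symm⟩

lemma hook_iff_of_le {e m M : ℕ} (he : 0 < e) {lam mu : Multiset ℕ} (hl : ∀ x ∈ lam, 0 < x)
    (hm : ∀ x ∈ mu, 0 < x) (hlm : Multiset.card lam ≤ m) (hmm : Multiset.card mu ≤ m)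
    (hM : m ≤ M) :
    (∃ x ∈ mvs e (betaSet lam M), betaSet mu M = mv e x (betaSet lam M)) ↔
      ∃ x ∈ mvs e (betaSet lam m), betaSet mu m = mv e x (betaSet lam m) := by
  induction M, hM using Nat.le_induction with
  | base => rfl
  | succ M hM ih =>
    rw [← ih, betaSet_succ hl (hlm.trans hM), betaSet_succ hm (hmm.trans hM), hook_shift_iff he]

lemma isHookRemoval_iff {e m : ℕ} (he : 0 < e) {lam mu : Multiset ℕ} (hl : ∀ x ∈ lam, 0 < x)
    (hm : ∀ x ∈ mu, 0 < x) (hlm : Multiset.card lam ≤ m) (hmm : Multiset.card mu ≤ m) :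
    IsHookRemoval e lam mu ↔
      ∃ x ∈ mvs e (betaSet lam m), betaSet mu m = mv e x (betaSet lam m) := by
  constructor
  · rintro ⟨-, -, -, m', x, h1, h2, h3, h4, h5, h6⟩
    rw [← hook_iff_of_le he hl hm hlm hmm (le_max_left m m'),
      hook_iff_of_le he hl hm h1 h2 (le_max_right m m')]
    exact ⟨x, mem_mvs.2 ⟨h3, h4, h5⟩, h6⟩
  · rintro ⟨x, hx, h⟩
    rw [mem_mvs] at hx
    exact ⟨hl, hm, he, m, x, hlm, hmm, hx.1, hx.2.1, hx.2.2, h⟩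

lemma oddP_partOfBeta (S : Finset ℕ) : OddP (partOfBeta S) ↔ par S = 1 := by
  rw [OddP, par, ZMod.natCast_eq_one_iff_odd]
  exact and_iff_right (partOfBeta_pos S)

lemma oddP_iff {lam : Multiset ℕ} {m : ℕ} (hpos : ∀ x ∈ lam, 0 < x)
    (hc : Multiset.card lam ≤ m) : OddP lam ↔ par (betaSet lam m) = 1 := by
  rw [← oddP_partOfBeta, partOfBeta_betaSet hpos hc]

lemma fkOp_partOfBeta {k : ℕ} {S : Finset ℕ} {x : ℕ} (hS : par S = 1) (hx : x ∈ mvs (2 ^ k) S)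
    (hxo : par (mv (2 ^ k) x S) = 1) :
    fkOp k (partOfBeta S) = partOfBeta (mv (2 ^ k) x S) := by
  have he : 0 < 2 ^ k := Nat.two_pow_pos k
  have hex : ∃ mu, IsHookRemoval (2 ^ k) (partOfBeta S) mu ∧ OddP mu := by
    refine ⟨partOfBeta (mv (2 ^ k) x S), ?_, (oddP_partOfBeta _).2 hxo⟩
    rw [isHookRemoval_iff he (partOfBeta_pos _) (partOfBeta_pos _) (card_partOfBeta_le S)
      ((card_partOfBeta_le _).trans (mv_card hx).le)]
    refine ⟨x, by rwa [betaSet_partOfBeta], ?_⟩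
    rw [betaSet_partOfBeta]
    conv_lhs => rw [← mv_card hx, betaSet_partOfBeta]
  rw [fkOp, dif_pos hex]
  obtain ⟨h1, h2⟩ := hex.choose_spec
  generalize hex.choose = mu at h1 h2 ⊢
  set nu := partOfBeta (mv (2 ^ k) x S) with hnu
  have hnup : ∀ x ∈ nu, 0 < x := partOfBeta_pos _
  have hcS := card_partOfBeta_le S
  have hcn : Multiset.card nu ≤ S.card := (card_partOfBeta_le _).trans (mv_card hx).le
  have h3 : IsHookRemoval (2 ^ k) (partOfBeta S) nu := by
    rw [isHookRemoval_iff he (partOfBeta_pos _) hnup hcS hcn]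
    refine ⟨x, by rwa [betaSet_partOfBeta], ?_⟩
    rw [betaSet_partOfBeta, hnu]
    conv_lhs => rw [← mv_card hx, betaSet_partOfBeta]
  have h4 : OddP nu := (oddP_partOfBeta _).2 hxo
  set M := max S.card (Multiset.card mu) with hM
  have hSM : Multiset.card (partOfBeta S) ≤ M := hcS.trans (le_max_left _ _)
  have hnM : Multiset.card nu ≤ M := hcn.trans (le_max_left _ _)
  have hmM : Multiset.card mu ≤ M := le_max_right _ _
  obtain ⟨y, hy, hy2⟩ := (isHookRemoval_iff he (partOfBeta_pos _) h2.1 hSM hmM).1 h1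
  obtain ⟨z, hz, hz2⟩ := (isHookRemoval_iff he (partOfBeta_pos _) hnup hSM hnM).1 h3
  have hyz : y = z := by
    refine odd_mv_unique k ?_ hy hz ?_ ?_
    · rwa [← oddP_iff (partOfBeta_pos _) hSM, oddP_partOfBeta]
    · rwa [← hy2, ← oddP_iff h2.1 hmM]
    · rwa [← hz2, ← oddP_iff hnup hnM]
  rw [← partOfBeta_betaSet h2.1 hmM, ← partOfBeta_betaSet hnup hnM, hy2, hz2, hyz]

lemma fkOp_eq_iff_hookSquare {k : ℕ} {S : Finset ℕ} (hS : par S = 1) (hk : 2 ^ (k + 1) ≤ wt S) :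
    fkOp k (fkOp k (partOfBeta S)) = fkOp (k + 1) (partOfBeta S) ↔
      HookSquare (2 ^ k) (2 ^ (k + 1)) S := by
  have h2 : 2 ^ (k + 1) = 2 ^ k + 2 ^ k := by ring
  obtain ⟨x, hx, hxo⟩ := exists_odd_mv (k := k) (S := S) (by omega) hS
  have hxw := mv_wt hx
  obtain ⟨y, hy, hyo⟩ := exists_odd_mv (k := k) (S := mv (2 ^ k) x S) (by omega) hxo
  obtain ⟨z, hz, hzo⟩ := exists_odd_mv (k := k + 1) (S := S) hk hS
  rw [fkOp_partOfBeta hS hx hxo, fkOp_partOfBeta hxo hy hyo, fkOp_partOfBeta hS hz hzo]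
  constructor
  · intro h
    refine ⟨x, hx, y, hy, z, hz, hxo, hyo, partOfBeta_inj ?_ h⟩
    rw [mv_card hy, mv_card hx, mv_card hz]
  · rintro ⟨x', hx', y', hy', z', hz', hxo', hyo', h⟩
    obtain rfl := odd_mv_unique k hS hx hx' hxo hxo'
    obtain rfl := odd_mv_unique k hxo hy hy' hyo hyo'
    obtain rfl := odd_mv_unique (k + 1) hS hz hz' hzo (by rw [← h]; exact hyo')
    rw [h]

/-- The bead sets with `m` beads and odd degree encoding a partition of `n`. -/
noncomputable def oddB (m n : ℕ) : Finset (Finset ℕ) :=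
  ((Finset.range (m + n)).powersetCard m).filter (fun S => wt S = n ∧ par S = 1)

lemma lt_of_mem {S : Finset ℕ} {x : ℕ} (hx : x ∈ S) : x < S.card + wt S := by
  have h1 : (S.filter (fun a => a < x)).card < S.card :=
    Finset.card_lt_card (Finset.filter_ssubset.2 ⟨x, hx, lt_irrefl x⟩)
  have h2 : gap S x ≤ wt S := Finset.single_le_sum (fun _ _ => Nat.zero_le _) hx
  rw [gap] at h2
  omega

lemma mem_oddB {m n : ℕ} {S : Finset ℕ} : S ∈ oddB m n ↔ S.card = m ∧ wt S = n ∧ par S = 1 := by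
  rw [oddB, Finset.mem_filter, Finset.mem_powersetCard]
  constructor
  · rintro ⟨⟨-, h1⟩, h2⟩
    exact ⟨h1, h2⟩
  · rintro ⟨h1, h2⟩
    refine ⟨⟨fun x hx => ?_, h1⟩, h2⟩
    have := lt_of_mem hx
    rw [Finset.mem_range]
    omega

lemma card_le_sum {s : Multiset ℕ} (h : ∀ x ∈ s, 0 < x) : Multiset.card s ≤ s.sum := by
  have := Multiset.card_nsmul_le_sum (s := s) (a := 1) h
  simpa using this

lemma partOfBeta_injOn (m n : ℕ) : Set.InjOn partOfBeta (oddB m n : Set (Finset ℕ)) := by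
  intro S hS T hT hST
  rw [Finset.mem_coe, mem_oddB] at hS hT
  exact partOfBeta_inj (hS.1.trans hT.1.symm) hST

lemma image_oddB {m n : ℕ} (hm : n ≤ m) :
    partOfBeta '' (oddB m n : Set (Finset ℕ)) = {lam | OddP lam ∧ lam.sum = n} := by
  ext lam
  simp only [Set.mem_ofPred_eq, Set.mem_image, Finset.mem_coe, mem_oddB]
  constructor
  · rintro ⟨S, ⟨h1, h2, h3⟩, rfl⟩
    exact ⟨(oddP_partOfBeta S).2 h3, by rw [partOfBeta_sum, h2]⟩
  · rintro ⟨h1, h2⟩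
    have hc : Multiset.card lam ≤ m := (card_le_sum h1.1).trans (by omega)
    refine ⟨betaSet lam m, ⟨card_betaSet h1.1 hc, ?_, (oddP_iff h1.1 hc).1 h1⟩,
      partOfBeta_betaSet h1.1 hc⟩
    rw [← partOfBeta_sum, partOfBeta_betaSet h1.1 hc, h2]

lemma Gnum_eq {k n m : ℕ} (hk : 2 ^ (k + 1) ≤ n) (hm : n ≤ m) :
    Gnum k n = ((oddB m n).filter (HookSquare (2 ^ k) (2 ^ (k + 1)))).card := by
  have hiff : ∀ S ∈ oddB m n, fkOp k (fkOp k (partOfBeta S)) = fkOp (k + 1) (partOfBeta S) ↔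
      HookSquare (2 ^ k) (2 ^ (k + 1)) S := fun S hS => by
    rw [mem_oddB] at hS
    exact fkOp_eq_iff_hookSquare hS.2.2 (by omega)
  have h : {lam : Multiset ℕ | OddP lam ∧ lam.sum = n ∧
      fkOp k (fkOp k lam) = fkOp (k + 1) lam} =
      partOfBeta '' (((oddB m n).filter (HookSquare (2 ^ k) (2 ^ (k + 1))) : Finset (Finset ℕ)) :
        Set (Finset ℕ)) := by
    ext lam
    rw [Set.mem_ofPred_eq, ← and_assoc]
    change lam ∈ {lam : Multiset ℕ | OddP lam ∧ lam.sum = n} ∧ _ ↔ _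
    rw [← image_oddB hm]
    simp only [Set.mem_image, Finset.mem_coe, Finset.mem_filter]
    constructor
    · rintro ⟨⟨S, h1, rfl⟩, h2⟩
      exact ⟨S, ⟨h1, (hiff S h1).1 h2⟩, rfl⟩
    · rintro ⟨S, ⟨h1, h2⟩, rfl⟩
      exact ⟨⟨S, h1, rfl⟩, (hiff S h1).2 h2⟩
  rw [Gnum, h, ← Set.ncard_coe_finset, Set.InjOn.ncard_image]
  exact (partOfBeta_injOn m n).mono (Finset.coe_subset.2 (Finset.filter_subset _ _))

/-- The sum of the powers `2 ^ b i` over the fiber of `c` at `s`. -/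
def fiberSum {ι κ : Type*} [Fintype ι] [DecidableEq κ] (b : ι → ℕ) (c : ι → κ) (s : κ) : ℕ :=
  ∑ i with c i = s, 2 ^ b i

lemma bits_sum_two_pow {ι : Type*} {b : ι → ℕ} (hb : Function.Injective b) (A : Finset ι) :
    bits (∑ i ∈ A, 2 ^ b i) = A.image b := by
  rw [← bits_sum (A.image b), Finset.sum_image hb.injOn]

section fiberSum

variable {ι κ : Type*} [Fintype ι] [DecidableEq κ] {b : ι → ℕ}

lemma sum_fiberSum [Fintype κ] (b : ι → ℕ) (c : ι → κ) :
    ∑ s, fiberSum b c s = ∑ i, 2 ^ b i :=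
  Finset.sum_fiberwise _ _ _

lemma mem_bits_fiberSum (hb : Function.Injective b) {c : ι → κ} {s : κ} {l : ℕ} :
    l ∈ bits (fiberSum b c s) ↔ ∃ i, c i = s ∧ b i = l := by
  rw [fiberSum, bits_sum_two_pow hb]
  simp

lemma digitsDisjoint_fiberSum (hb : Function.Injective b) (c : ι → κ) :
    DigitsDisjoint (fiberSum b c) := by
  intro s t hst
  rw [Finset.disjoint_left]
  intro l hs ht
  rw [mem_bits_fiberSum hb] at hs ht
  obtain ⟨i, rfl, rfl⟩ := hs
  obtain ⟨j, rfl, h⟩ := ht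
  exact hst (by rw [hb h])

lemma fiberSum_injective (hb : Function.Injective b) :
    Function.Injective (fiberSum b : (ι → κ) → κ → ℕ) := by
  intro c d h
  funext i
  have h1 : b i ∈ bits (fiberSum b c (c i)) := (mem_bits_fiberSum hb).2 ⟨i, rfl, rfl⟩
  rw [h, mem_bits_fiberSum hb] at h1
  obtain ⟨j, h2, h3⟩ := h1
  rw [← h2, hb h3]

lemma exists_fiberSum [Fintype κ] (hb : Function.Injective b) {v : κ → ℕ} (hv : DigitsDisjoint v)
    (hsum : ∑ s, v s = ∑ i, 2 ^ b i) : ∃ c : ι → κ, v = fiberSum b c := by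
  have h1 : ∀ i, ∃ s, b i ∈ bits (v s) := by
    intro i
    rw [← hv.mem_bits_sum, hsum, bits_sum_two_pow hb]
    exact Finset.mem_image_of_mem _ (Finset.mem_univ i)
  choose c hc using h1
  refine ⟨c, funext fun s => ?_⟩
  rw [← sum_bits (v s), ← sum_bits (fiberSum b c s)]
  congr 1
  ext l
  rw [mem_bits_fiberSum hb]
  constructor
  · intro hl
    have h2 : l ∈ bits (∑ s, v s) := hv.mem_bits_sum.2 ⟨s, hl⟩
    rw [hsum, bits_sum_two_pow hb, Finset.mem_image] at h2
    obtain ⟨i, -, rfl⟩ := h2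
    exact ⟨i, hv.eq_of_mem (hc i) hl, rfl⟩
  · rintro ⟨i, rfl, rfl⟩
    exact hc i

end fiberSum

lemma range_subset {S : Finset ℕ} : Finset.range (S.card - wt S) ⊆ S := by
  intro y hy
  rw [Finset.mem_range] at hy
  by_contra hyS
  have h1 : (S.filter (fun x => y < x)).card ≤ wt S := by
    rw [Finset.card_eq_sum_ones, wt]
    refine (Finset.sum_le_sum fun x hx => ?_).trans
      (Finset.sum_le_sum_of_subset (Finset.filter_subset _ _))
    rw [Finset.mem_filter] at hx
    have h2 := gap_succ_notMem hyS
    have h3 := gap_mono S (show y + 1 ≤ x from hx.2)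
    omega
  have h2 : S.card = (S.filter (fun x => y < x)).card + (S.filter (fun x => ¬ y < x)).card :=
    (Finset.card_filter_add_card_filter_not _).symm
  have h3 : (S.filter (fun x => ¬ y < x)).card ≤ (S.filter (fun x => x < y)).card := by
    refine Finset.card_le_card fun x hx => ?_
    rw [Finset.mem_filter] at hx ⊢
    have : x ≠ y := fun h => hyS (h ▸ hx.1)
    exact ⟨hx.1, by omega⟩
  have h4 := card_filter_lt_le S y
  omega

lemma le_card_run {E n : ℕ} {S : Finset ℕ} (h : E * n + wt S ≤ S.card) (s : Fin E) :
    n ≤ (run S s).card := by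
  conv_lhs => rw [← Finset.card_range n]
  refine Finset.card_le_card fun y hy => ?_
  rw [Finset.mem_range] at hy
  rw [mem_run]
  refine range_subset (Finset.mem_range.2 ?_)
  have h1 : E * y + E ≤ E * n := by
    rw [← Nat.mul_succ]
    exact Nat.mul_le_mul_left E hy
  have := s.isLt
  omega

lemma wt_run_eq_zero {E : ℕ} {S : Finset ℕ} (h : wt S < E) (s : Fin E) : wt (run S s) = 0 := by
  have h1 := wt_eq_run (by omega : 0 < E) S
  have h2 := le_sum_univ (fun s : Fin E => wt (run S s)) s
  have h3 : ∑ s : Fin E, wt (run S s) = 0 := by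
    by_contra h3
    have := Nat.le_mul_of_pos_right E (Nat.pos_of_ne_zero h3)
    omega
  omega

lemma coreB_eq_self {E : ℕ} {S : Finset ℕ} (h : wt S < E) : coreB E S = S := by
  conv_rhs => rw [← asm_run (by omega : 0 < E) S]
  rw [coreB]
  congr 1
  funext s
  exact (eq_range_of_wt (wt_run_eq_zero h s)).symm

section fiberCount

variable {ι : Type*} [Fintype ι] {k m n n₀ : ℕ} {b : ι → ℕ}

lemma oddB_asm_iff (hn : n = 2 ^ k * ∑ i, 2 ^ b i + n₀) (hn₀ : n₀ < 2 ^ k)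
    (hb : Function.Injective b) (T : Fin (2 ^ k) → Finset ℕ) :
    asm T ∈ oddB m n ↔ coreT T ∈ oddB m n₀ ∧
      ∃ c : ι → Fin (2 ^ k), ∀ s, T s ∈ oddB (T s).card (fiberSum b c s) := by
  have hc : (coreT T).card = (asm T).card := by
    rw [coreT, card_asm, card_asm]
    simp
  have hw : wt (asm T) = 2 ^ k * ∑ s, wt (T s) + wt (coreT T) := wt_asm T
  rw [mem_oddB, mem_oddB, par_asm_eq_one, hc]
  constructor
  · rintro ⟨h1, h2, h3, h4, h5, h6⟩
    have h7 : wt (coreT T) = n₀ ∧ ∑ s, wt (T s) = ∑ i, 2 ^ b i := by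
      have h8 : (2 ^ k * ∑ s, wt (T s) + wt (coreT T)) = 2 ^ k * ∑ i, 2 ^ b i + n₀ := by
        rw [← hw, h2, hn]
      have h9 := congrArg (· % 2 ^ k) h8
      have h10 := congrArg (· / 2 ^ k) h8
      simp only [Nat.mul_add_mod, Nat.mod_eq_of_lt h3, Nat.mod_eq_of_lt hn₀] at h9
      simp only [Nat.mul_add_div (Nat.two_pow_pos k), Nat.div_eq_of_lt h3,
        Nat.div_eq_of_lt hn₀] at h10
      exact ⟨h9, h10⟩
    refine ⟨⟨h1, h7.1, h4⟩, ?_⟩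
    obtain ⟨c, hc⟩ := exists_fiberSum hb h5 h7.2
    exact ⟨c, fun s => mem_oddB.2 ⟨rfl, congrFun hc s, h6 s⟩⟩
  · rintro ⟨⟨h1, h2, h3⟩, c, h4⟩
    have h5 : (fun s => wt (T s)) = fiberSum b c := funext fun s => (mem_oddB.1 (h4 s)).2.1
    refine ⟨h1, ?_, by rw [h2]; exact hn₀, h3, ?_, fun s => (mem_oddB.1 (h4 s)).2.2⟩
    · rw [hw, h2, h5, sum_fiberSum, hn]
    · rw [h5]
      exact digitsDisjoint_fiberSum hb c

/-- Odd bead sets with a prescribed core are counted runner by runner. -/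
lemma card_filter_oddB [DecidableEq ι] (hn : n = 2 ^ k * ∑ i, 2 ^ b i + n₀) (hn₀ : n₀ < 2 ^ k)
    (hb : Function.Injective b) (hm : 2 ^ k * n + n ≤ m) (P : Finset ℕ → Prop)
    (Q : (ι → Fin (2 ^ k)) → Fin (2 ^ k) → Finset ℕ → Prop)
    (N : (ι → Fin (2 ^ k)) → Fin (2 ^ k) → ℕ)
    (hP : ∀ T : Fin (2 ^ k) → Finset ℕ, par (asm T) = 1 → ∀ c, (∀ s, wt (T s) = fiberSum b c s) →
      (P (asm T) ↔ ∀ s, Q c s (T s)))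
    (hN : ∀ c s m', n ≤ m' → ((oddB m' (fiberSum b c s)).filter (Q c s)).card = N c s) :
    ((oddB m n).filter P).card = (oddB m n₀).card * ∑ c, ∏ s, N c s := by
  have hE : 0 < 2 ^ k := Nat.two_pow_pos k
  have hmaps : ∀ S ∈ (oddB m n).filter P, coreB (2 ^ k) S ∈ oddB m n₀ := by
    intro S hS
    rw [Finset.mem_filter] at hS
    have h1 := hS.1
    rw [← asm_run hE S, oddB_asm_iff hn hn₀ hb] at h1
    exact h1.1
  rw [Finset.card_eq_sum_card_fiberwise hmaps, ← smul_eq_mul, ← Finset.sum_const]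
  refine Finset.sum_congr rfl fun C hC => ?_
  have hC' := mem_oddB.1 hC
  have hCw : wt C < 2 ^ k := by omega
  have hsize : ∀ s : Fin (2 ^ k), n ≤ (run C s).card := fun s => le_card_run (by omega) s
  have hset : ((oddB m n).filter P).filter (fun S => coreB (2 ^ k) S = C) =
      (Finset.univ.biUnion fun c => Fintype.piFinset fun s =>
        (oddB (run C s).card (fiberSum b c s)).filter (Q c s)).image asm := by
    ext S
    obtain ⟨T, rfl⟩ : ∃ T : Fin (2 ^ k) → Finset ℕ, S = asm T := ⟨run S, (asm_run hE S).symm⟩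
    rw [asm_injective.mem_finset_image]
    simp only [Finset.mem_filter, Finset.mem_biUnion, Finset.mem_univ, true_and,
      Fintype.mem_piFinset]
    constructor
    · rintro ⟨⟨h1, h2⟩, h3⟩
      have h1' := (mem_oddB.1 h1).2.2
      obtain ⟨h4, c, h5⟩ := (oddB_asm_iff hn hn₀ hb T).1 h1
      refine ⟨c, fun s => ?_⟩
      have h6 : (run C s).card = (T s).card := by
        rw [← h3, coreB_asm, run_asm, Finset.card_range]
      rw [h6]
      exact ⟨h5 s, (hP T h1' c fun s => (mem_oddB.1 (h5 s)).2.1).1 h2 s⟩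
    · rintro ⟨c, h1⟩
      have h2 : coreB (2 ^ k) (asm T) = C := by
        rw [coreB_asm]
        conv_rhs => rw [← coreB_eq_self hCw, coreB]
        congr 1
        funext s
        rw [(mem_oddB.1 (h1 s).1).1]
      have h3 : asm T ∈ oddB m n := by
        rw [oddB_asm_iff hn hn₀ hb]
        refine ⟨?_, c, fun s => ?_⟩
        · rw [coreT, ← coreB_asm, h2]
          exact hC
        · rw [(mem_oddB.1 (h1 s).1).1]
          exact (h1 s).1
      exact ⟨⟨h3, (hP T (mem_oddB.1 h3).2.2 c fun s => (mem_oddB.1 (h1 s).1).2.1).2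
        fun s => (h1 s).2⟩, h2⟩
  rw [hset, Finset.card_image_of_injective _ asm_injective, Finset.card_biUnion]
  · refine Finset.sum_congr rfl fun c _ => ?_
    rw [Fintype.card_piFinset]
    exact Finset.prod_congr rfl fun s _ => hN c s _ (hsize s)
  · intro c _ d _ hcd
    rw [Function.onFun, Finset.disjoint_left]
    intro T hc hd
    rw [Fintype.mem_piFinset] at hc hd
    refine hcd (fiberSum_injective hb (funext fun s => ?_))
    have h1 := (mem_oddB.1 (Finset.mem_filter.1 (hc s)).1).2.1
    have h2 := (mem_oddB.1 (Finset.mem_filter.1 (hd s)).1).2.1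
    rw [← h1, h2]

end fiberCount

lemma card_oddB_zero (m : ℕ) : (oddB m 0).card = 1 := by
  rw [Finset.card_eq_one]
  refine ⟨Finset.range m, ?_⟩
  ext S
  rw [mem_oddB, Finset.mem_singleton]
  constructor
  · rintro ⟨h1, h2, -⟩
    rw [eq_range_of_wt h2, h1]
  · rintro rfl
    exact ⟨Finset.card_range m, wt_range m, par_of_wt (wt_range m)⟩

lemma card_oddB_eq_ncard {m n : ℕ} (hm : n ≤ m) :
    (oddB m n).card = {lam : Multiset ℕ | OddP lam ∧ lam.sum = n}.ncard := by
  rw [← image_oddB hm, Set.InjOn.ncard_image (partOfBeta_injOn _ _), Set.ncard_coe_finset]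

lemma card_oddB_one {m : ℕ} (hm : 1 ≤ m) : (oddB m 1).card = 1 := by
  rw [card_oddB_eq_ncard hm, ← card_oddB_eq_ncard le_rfl, Finset.card_eq_one]
  refine ⟨{1}, ?_⟩
  have hw : wt {1} = 1 := by have := wt_add {1}; simpa using this
  ext S
  rw [mem_oddB, Finset.mem_singleton]
  constructor
  · rintro ⟨h1, h2, -⟩
    obtain ⟨x, rfl⟩ := Finset.card_eq_one.1 h1
    have := wt_add {x}
    simp at this
    rw [← this, h2]
  · rintro rfl
    refine ⟨rfl, hw, ?_⟩
    have h1 : mvs 1 {1} = {1} := by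
      ext x
      rw [mem_mvs, Finset.mem_singleton, Finset.mem_singleton]
      omega
    rw [par_rec (by omega), h1, Finset.sum_singleton]
    have := mv_wt (e := 1) (x := 1) (S := {1}) (by rw [h1]; simp)
    exact par_of_wt (by omega)

/-- The number of odd partitions of `n` is the product of the powers of two occurring in `n`. -/
lemma card_oddB {n : ℕ} : ∀ {m : ℕ}, n ≤ m → (oddB m n).card = ∏ i ∈ bits n, 2 ^ i := by
  induction n using Nat.strong_induction_on with
  | _ n ih =>
  intro m hm
  rcases Nat.eq_zero_or_pos n with rfl | hn
  · have : bits 0 = ∅ := bits_sum ∅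
    rw [card_oddB_zero, this, Finset.prod_empty]
  · obtain ⟨a, h1, h2⟩ : ∃ a, 2 ^ a ≤ n ∧ n < 2 ^ (a + 1) :=
      ⟨Nat.log 2 n, Nat.pow_log_le_self 2 hn.ne', Nat.lt_pow_succ_log_self (by norm_num) n⟩
    have h3 : a ∈ bits n := top_mem_bits h1 h2
    rw [card_oddB_eq_ncard hm, ← card_oddB_eq_ncard (m := 2 ^ a * n + n) (by omega)]
    have h4 := card_filter_oddB (k := a) (m := 2 ^ a * n + n) (n := n) (n₀ := n - 2 ^ a)
      (ι := Unit) (b := fun _ => 0) (by simp; omega) (by rw [pow_succ] at h2; omega)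
      (fun _ _ _ => rfl) le_rfl (fun _ => True) (fun _ _ _ => True) (fun _ _ => 1)
      (fun _ _ _ _ => by simp) ?_
    · rw [Finset.filter_true] at h4
      have h5 : 0 < 2 ^ a := Nat.two_pow_pos a
      rw [h4, ih (n - 2 ^ a) (by omega) (by omega), bits_sub_mem h3, ← Finset.mul_prod_erase _ _ h3,
        mul_comm]
      simp
    · intro c s m' hm'
      rw [Finset.filter_true]
      by_cases h : c () = s
      · have : fiberSum (fun _ : Unit => 0) c s = 1 := by simp [fiberSum, h, Finset.filter_true_of_mem]
        rw [this, card_oddB_one (by omega)]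
      · have : fiberSum (fun _ : Unit => 0) c s = 0 := by simp [fiberSum, h]
        rw [this, card_oddB_zero]

lemma card_functions_fiber {ι κ : Type*} [Fintype ι] [Fintype κ]
    [DecidableEq ι] [DecidableEq κ] (σ : κ) (J : Finset ι) :
    (Finset.univ.filter fun c : ι → κ => ∀ i, c i = σ ↔ i ∈ J).card =
      (Fintype.card κ - 1) ^ Jᶜ.card := by
  have h : (Finset.univ.filter fun c : ι → κ => ∀ i, c i = σ ↔ i ∈ J) =
      Fintype.piFinset fun i => if i ∈ J then {σ} else Finset.univ.erase σ := by
    ext c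
    simp only [Finset.mem_filter, Finset.mem_univ, true_and, Fintype.mem_piFinset]
    refine forall_congr' fun i => ?_
    by_cases hi : i ∈ J <;> simp [hi]
  rw [h, Fintype.card_piFinset, ← Finset.prod_mul_prod_compl J,
    Finset.prod_congr rfl (g := fun _ => 1), Finset.prod_const_one, one_mul,
    Finset.prod_congr rfl (g := fun _ => Fintype.card κ - 1), Finset.prod_const]
  · intro i hi
    rw [if_neg (Finset.mem_compl.1 hi), Finset.card_erase_of_mem (Finset.mem_univ _),
      Finset.card_univ]
  · intro i hi
    rw [if_pos hi, Finset.card_singleton]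

lemma sum_functions_fiber {ι κ : Type*} [Fintype ι] [Fintype κ]
    [DecidableEq ι] [DecidableEq κ] (p q : ι) (F : Finset ι → ℕ) :
    ∑ c : ι → κ, (if c p = c q then F (Finset.univ.filter fun i => c i = c q) else 0) =
      Fintype.card κ * ∑ J : Finset ι with p ∈ J ∧ q ∈ J,
        (Fintype.card κ - 1) ^ Jᶜ.card * F J := by
  have h1 : ∀ c : ι → κ,
      (if c p = c q then F (Finset.univ.filter fun i => c i = c q) else 0) =
        ∑ σ : κ, ∑ J : Finset ι with p ∈ J ∧ q ∈ J,
          if ∀ i, c i = σ ↔ i ∈ J then F J else 0 := by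
    intro c
    have hJ : ∀ (σ : κ) (J : Finset ι), (∀ i, c i = σ ↔ i ∈ J) →
        J = Finset.univ.filter fun i => c i = σ := fun σ J h => by
      ext i
      simp [h i]
    rw [Finset.sum_eq_single (c q)]
    · split_ifs with hpq
      · rw [Finset.sum_eq_single (Finset.univ.filter fun i => c i = c q)]
        · rw [if_pos (by simp)]
        · intro J _ hne
          exact if_neg fun h => hne (hJ _ _ h)
        · intro h
          simp [hpq] at h
      · refine (Finset.sum_eq_zero fun J hJ' => if_neg fun h => hpq ?_).symm
        exact (h p).2 (Finset.mem_filter.1 hJ').2.1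
    · intro σ _ hσ
      refine Finset.sum_eq_zero fun J hJ' => if_neg fun h => hσ ?_
      exact ((h q).2 (Finset.mem_filter.1 hJ').2.2).symm
    · simp
  rw [Finset.sum_congr rfl fun c _ => h1 c, Finset.sum_comm, ← Finset.card_univ (α := κ),
    ← smul_eq_mul, ← Finset.sum_const]
  refine Finset.sum_congr rfl fun σ _ => ?_
  rw [Finset.sum_comm]
  refine Finset.sum_congr rfl fun J _ => ?_
  rw [← Finset.sum_filter, Finset.sum_const, card_functions_fiber, smul_eq_mul, Finset.card_univ]

lemma prod_fiber_ite {ι κ : Type*} [Fintype ι] [Fintype κ]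
    [DecidableEq ι] [DecidableEq κ] (c : ι → κ) (σ : κ) (x : ℕ)
    (f : ι → ℕ) :
    ∏ s, (if s = σ then x else ∏ i with c i = s, f i) =
      x * ∏ i ∈ (Finset.univ.filter fun i => c i = σ)ᶜ, f i := by
  rw [← Finset.mul_prod_erase _ _ (Finset.mem_univ σ), if_pos rfl]
  congr 1
  rw [← Finset.prod_fiberwise_of_maps_to (t := Finset.univ.erase σ) (g := c)]
  · refine Finset.prod_congr rfl fun s hs => ?_
    have hs' := Finset.ne_of_mem_erase hs
    rw [if_neg hs']
    refine Finset.prod_congr ?_ fun _ _ => rfl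
    ext i
    simp only [Finset.mem_filter, Finset.mem_univ, true_and, Finset.mem_compl]
    exact ⟨fun h => ⟨h ▸ hs', h⟩, fun h => h.2⟩
  · intro i hi
    simpa using hi

lemma card_oddB_fiberSum {ι κ : Type*} [Fintype ι] [DecidableEq κ] {b : ι → ℕ} (hb : Function.Injective b)
    (c : ι → κ) (s : κ) {m : ℕ} (hm : fiberSum b c s ≤ m) :
    (oddB m (fiberSum b c s)).card = ∏ i with c i = s, 2 ^ b i := by
  rw [card_oddB hm, fiberSum, bits_sum_two_pow hb, Finset.prod_image hb.injOn]

/-- The counting formula, for digits of `n` above `k` indexed by an arbitrary type. -/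
theorem Gnum_eq_sum {ι : Type*} [Fintype ι] [DecidableEq ι] {k n n₀ : ℕ} {b : ι → ℕ} (hb : Function.Injective b)
    (hn : n = 2 ^ k * ∑ i, 2 ^ b i + n₀) (hn₀ : n₀ < 2 ^ k) {p q : ι} (hq : ∀ i, b q ≤ b i)
    (hp1 : 1 ≤ b p) (hp : ∀ i, 1 ≤ b i → b p ≤ b i) :
    Gnum k n = (∏ i ∈ bits n₀, 2 ^ i) * 2 ^ k * ∑ J : Finset ι with p ∈ J ∧ q ∈ J,
      (2 ^ k - 1) ^ Jᶜ.card * ((∏ i ∈ Jᶜ, 2 ^ b i) * Gnum 0 (∑ i ∈ J, 2 ^ b i)) := by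
  have hle : ∀ (c : ι → Fin (2 ^ k)) s, fiberSum b c s ≤ n := by
    intro c s
    have h1 := le_sum_univ (fiberSum b c) s
    rw [sum_fiberSum] at h1
    have := Nat.le_mul_of_pos_left (∑ i, 2 ^ b i) (Nat.two_pow_pos k)
    omega
  have hkn : 2 ^ (k + 1) ≤ n := by
    have h1 : 2 ^ b p ≤ ∑ i, 2 ^ b i := le_sum_univ (fun i => 2 ^ b i) p
    have h2 : 2 ^ 1 ≤ 2 ^ b p := Nat.pow_le_pow_right (by norm_num) hp1
    have h3 := Nat.mul_le_mul_left (2 ^ k) (h2.trans h1)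
    rw [← pow_add] at h3
    omega
  rw [Gnum_eq hkn (show n ≤ 2 ^ k * n + n by omega)]
  rw [card_filter_oddB hn hn₀ hb le_rfl (HookSquare (2 ^ k) (2 ^ (k + 1)))
    (fun c s X => c p = c q ∧ (s = c q → HookSquare 1 2 X))
    (fun c s => if c p = c q then (if s = c q then Gnum 0 (fiberSum b c s)
      else ∏ i with c i = s, 2 ^ b i) else 0)]
  · have h1 : n₀ ≤ 2 ^ k * n + n := by
      have := Nat.zero_le (2 ^ k * ∑ i, 2 ^ b i)
      omega
    rw [card_oddB h1, mul_assoc]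
    congr 1
    have h2 := sum_functions_fiber (κ := Fin (2 ^ k)) p q
      (fun J => (∏ i ∈ Jᶜ, 2 ^ b i) * Gnum 0 (∑ i ∈ J, 2 ^ b i))
    rw [Fintype.card_fin] at h2
    rw [← h2]
    refine Finset.sum_congr rfl fun c _ => ?_
    by_cases h : c p = c q
    · simp only [if_pos h]
      have h3 : ∀ s, (if s = c q then Gnum 0 (fiberSum b c s) else ∏ i with c i = s, 2 ^ b i) =
          if s = c q then Gnum 0 (fiberSum b c (c q)) else ∏ i with c i = s, 2 ^ b i := by
        intro s
        by_cases hs : s = c q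
        · rw [hs]
        · rw [if_neg hs, if_neg hs]
      rw [Finset.prod_congr rfl fun s _ => h3 s, prod_fiber_ite, mul_comm]
      rfl
    · simp only [if_neg h]
      exact Finset.prod_eq_zero (Finset.mem_univ (c q)) rfl
  · intro T hT c hw
    have hbits : bits (∑ s, wt (T s)) = Finset.univ.image b := by
      rw [Finset.sum_congr rfl fun s _ => hw s, sum_fiberSum, bits_sum_two_pow hb]
    have h1 := hookSquare_asm hT (l₀ := b q) (l₁ := b p) (σ₀ := c q) (σ₁ := c p)
      (by rw [hw]; exact (mem_bits_fiberSum hb).2 ⟨q, rfl, rfl⟩)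
      (by rw [hbits]; simpa using hq)
      (by rw [hw]; exact (mem_bits_fiberSum hb).2 ⟨p, rfl, rfl⟩) hp1
      (by rw [hbits]; simpa using hp)
    rw [mul_one, ← pow_succ] at h1
    rw [h1]
    constructor
    · rintro ⟨h2, h3⟩ s
      exact ⟨h2.symm, fun h => h ▸ h3⟩
    · intro h
      exact ⟨(h (c q)).1.symm, (h (c q)).2 rfl⟩
  · intro c s m' hm'
    have hm'' := (hle c s).trans hm'
    by_cases h : c p = c q
    · by_cases hs : s = c q
      · simp only [h, hs, true_and, if_true, forall_const]
        rw [hs] at hm''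
        refine (Gnum_eq (k := 0) ?_ hm'').symm
        have h1 : b p ∈ bits (fiberSum b c (c q)) := (mem_bits_fiberSum hb).2 ⟨p, h, rfl⟩
        exact (Nat.pow_le_pow_right (by norm_num) hp1).trans (two_pow_le_of_mem_bits h1)
      · simp only [h, hs, true_and, if_true, if_false, false_imp_iff, Finset.filter_true]
        exact card_oddB_fiberSum hb c s hm''
    · simp only [h, false_and, if_false, Finset.filter_false, Finset.card_empty]

theorem stmt8 (k n r : ℕ) (hkn : 2 ^ (k + 1) ≤ n) (a : ℕ → ℕ)
    (hdec : ∀ i j, 1 ≤ i → i < j → j ≤ r → a j < a i)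
    (hn : n = ∑ i ∈ Finset.Icc 1 r, 2 ^ a i)
    (p q : ℕ) (hp : p ∈ Finset.Icc 1 r) (hap : k + 1 ≤ a p)
    (hpmax : ∀ i ∈ Finset.Icc 1 r, k + 1 ≤ a i → i ≤ p)
    (hq : q ∈ Finset.Icc 1 r) (haq : k ≤ a q)
    (hqmax : ∀ i ∈ Finset.Icc 1 r, k ≤ a i → i ≤ q) :
    Gnum k n = (∏ j ∈ Finset.Icc (q + 1) r, 2 ^ a j) * 2 ^ k *
      ∑ J ∈ (Finset.Icc 1 q).powerset.filter (fun J => p ∈ J ∧ q ∈ J),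
        (∏ i ∈ Finset.Icc 1 q \ J, 2 ^ (a i - k)) *
          (2 ^ k - 1) ^ (Finset.Icc 1 q \ J).card *
          Gnum 0 (∑ j ∈ J, 2 ^ (a j - k)) := by
  have hpq : p ≤ q := hqmax p hp (by omega)
  rw [Finset.mem_Icc] at hp hq
  have hanti : ∀ i j, 1 ≤ i → i ≤ j → j ≤ r → a j ≤ a i := by
    intro i j h1 h2 h3
    rcases h2.eq_or_lt with rfl | h
    · exact le_rfl
    · exact (hdec i j h1 h h3).le
  have hinj : Set.InjOn a (Finset.Icc 1 r) := by
    intro i hi j hj h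
    rw [Finset.mem_coe, Finset.mem_Icc] at hi hj
    rcases lt_trichotomy i j with h1 | h1 | h1
    · have := hdec i j hi.1 h1 hj.2
      omega
    · exact h1
    · have := hdec j i hj.1 h1 hi.2
      omega
  have hak : ∀ i ∈ Finset.Icc 1 q, k ≤ a i := fun i hi => by
    rw [Finset.mem_Icc] at hi
    exact haq.trans (hanti i q hi.1 hi.2 hq.2)
  set n₀ := ∑ j ∈ Finset.Icc (q + 1) r, 2 ^ a j with hn₀
  have hinj₀ : Set.InjOn a (Finset.Icc (q + 1) r) :=
    hinj.mono (Finset.coe_subset.2 (Finset.Icc_subset_Icc_left (by omega)))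
  have hbits₀ : bits n₀ = (Finset.Icc (q + 1) r).image a := by
    rw [hn₀, ← bits_sum ((Finset.Icc (q + 1) r).image a), Finset.sum_image hinj₀]
  have hlt : n₀ < 2 ^ k := by
    refine lt_two_pow_of_bits fun i hi => ?_
    rw [hbits₀, Finset.mem_image] at hi
    obtain ⟨j, hj, rfl⟩ := hi
    rw [Finset.mem_Icc] at hj
    by_contra h
    have := hqmax j (Finset.mem_Icc.2 ⟨by omega, hj.2⟩) (by omega)
    omega
  have hsplit : n = 2 ^ k * ∑ i : Finset.Icc 1 q, 2 ^ (a i - k) + n₀ := by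
    have h1 : Finset.Icc 1 r = Finset.Icc 1 q ∪ Finset.Icc (q + 1) r := by
      ext i
      simp only [Finset.mem_union, Finset.mem_Icc]
      omega
    have h2 : Disjoint (Finset.Icc 1 q) (Finset.Icc (q + 1) r) := by
      rw [Finset.disjoint_left]
      intro i h3 h4
      rw [Finset.mem_Icc] at h3 h4
      omega
    rw [hn, h1, Finset.sum_union h2, Finset.sum_coe_sort (Finset.Icc 1 q) fun i => 2 ^ (a i - k),
      Finset.mul_sum]
    congr 1
    refine Finset.sum_congr rfl fun i hi => ?_
    rw [← pow_add, Nat.add_sub_cancel' (hak i hi)]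
  have hmem : ∀ i : Finset.Icc 1 q, 1 ≤ (i : ℕ) ∧ (i : ℕ) ≤ q := fun i => Finset.mem_Icc.1 i.2
  have hb : Function.Injective fun i : Finset.Icc 1 q => a i - k := by
    intro i j h
    have h1 := hak i i.2
    have h2 := hak j j.2
    refine Subtype.ext (hinj ?_ ?_ (by dsimp only at h; omega))
    · exact Finset.mem_coe.2 (Finset.mem_Icc.2 ⟨(hmem i).1, (hmem i).2.trans hq.2⟩)
    · exact Finset.mem_coe.2 (Finset.mem_Icc.2 ⟨(hmem j).1, (hmem j).2.trans hq.2⟩)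
  have key := Gnum_eq_sum hb hsplit hlt (p := ⟨p, Finset.mem_Icc.2 ⟨hp.1, hpq⟩⟩)
    (q := ⟨q, Finset.mem_Icc.2 ⟨hq.1, le_rfl⟩⟩) ?_ ?_ ?_
  · rw [key, hbits₀, Finset.prod_image hinj₀]
    congr 1
    have hsd : ∀ J : Finset (Finset.Icc 1 q),
        Finset.Icc 1 q \ J.map (Function.Embedding.subtype _) =
          Jᶜ.map (Function.Embedding.subtype _) := by
      intro J
      ext i
      simp only [Finset.mem_sdiff, Finset.mem_map, Finset.mem_compl,
        Function.Embedding.subtype_apply]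
      constructor
      · rintro ⟨h1, h2⟩
        exact ⟨⟨i, h1⟩, fun h => h2 ⟨_, h, rfl⟩, rfl⟩
      · rintro ⟨j, h1, rfl⟩
        refine ⟨j.2, ?_⟩
        rintro ⟨l, h2, h3⟩
        exact h1 (Subtype.ext h3 ▸ h2)
    refine Finset.sum_bij (fun J _ => J.map (Function.Embedding.subtype _)) ?_ ?_ ?_ ?_
    · intro J hJ
      rw [Finset.mem_filter] at hJ
      rw [Finset.mem_filter, Finset.mem_powerset]
      refine ⟨fun i hi => ?_, ?_, ?_⟩
      · obtain ⟨j, -, rfl⟩ := Finset.mem_map.1 hi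
        exact j.2
      · exact Finset.mem_map.2 ⟨_, hJ.2.1, rfl⟩
      · exact Finset.mem_map.2 ⟨_, hJ.2.2, rfl⟩
    · intro J _ K _ h
      exact Finset.map_injective _ h
    · intro J hJ
      rw [Finset.mem_filter, Finset.mem_powerset] at hJ
      refine ⟨J.subtype (· ∈ Finset.Icc 1 q), ?_, Finset.subtype_map_of_mem fun i hi => hJ.1 hi⟩
      simpa using hJ.2
    · intro J _
      rw [hsd, Finset.card_map, Finset.prod_map, Finset.sum_map]
      simp only [Function.Embedding.subtype_apply]
      ring
  · intro i
    exact Nat.sub_le_sub_right (hanti i q (hmem i).1 (hmem i).2 hq.2) k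
  · change 1 ≤ a p - k
    omega
  · intro i hi
    have h1 := hmem i
    have h2 := hpmax i (Finset.mem_Icc.2 ⟨h1.1, h1.2.trans hq.2⟩) (by omega)
    exact Nat.sub_le_sub_right (hanti i p h1.1 h2 hp.2) k

end OddSym
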